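/- Let c>0, let c_1,…,c_N>0 be fixed, let 1<κ<2, μ>0, and δ>0. Then there exists a constant C>0, depending only on κ, μ, δ, c and c_1,…,c_N, such that the following holds: if G:[0,∞)×ℝ³→ℝ is smooth and u is a smooth solution of ∂_t²u−c²Δ_x u=G on (0,∞)×ℝ³ with u(0,·)=0 and ∂_t u(0,·)=0, then for every (t,x)∈(0,∞)×ℝ³ with |x|>δt, ⟨t+|x|⟩²·⟨ct−|x|⟩^{κ−1}·|D_{+,c}u(t,x)| ≤ C·A_{κ,μ,2}[G;c](t,x). -/

import Mathlib

noncomputable section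

namespace PaperKatayama

/-- Euclidean 3-space. -/
abbrev E3 := EuclideanSpace ℝ (Fin 3)

/-- Space-time functions. -/
abbrev Fn := ℝ → E3 → ℝ

/-- Functions of the space variable alone. -/
abbrev SFn := E3 → ℝ

/-- The Japanese bracket `⟨a⟩ = √(1+a²)`. -/
def jb (a : ℝ) : ℝ := Real.sqrt (1 + a ^ 2)

/-- Time derivative `∂_t`. -/
def pt (f : Fn) : Fn := fun t x => deriv (fun s => f s x) t

/-- Spatial derivative `∂_j` (j = 1,2,3, here indexed by `Fin 3`). -/
def pd (j : Fin 3) (f : Fn) : Fn :=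
  fun t x => fderiv ℝ (f t) x (EuclideanSpace.single j 1)

/-- `∂_a` for `a ∈ {0,1,2,3}`, with `∂_0 = ∂_t`. -/
def pda (a : Fin 4) : Fn → Fn := Fin.cases pt (fun j => pd j) a

/-- Rotation field `Ω_{jk} = x_j ∂_k − x_k ∂_j`, extended antisymmetrically
(so `rotA k j = − rotA j k`, and `rotA j j = 0`). -/
def rotA (j k : Fin 3) (f : Fn) : Fn :=
  fun t x => x j * pd k f t x - x k * pd j f t x

/-- Radial derivative `∂_r = Σ_j (x_j/r) ∂_j`. -/
def pr (f : Fn) : Fn := fun t x => ∑ j, (x j / ‖x‖) * pd j f t x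

/-- `D_{+,c} = ∂_t + c ∂_r`. -/
def Dp (c : ℝ) (f : Fn) : Fn := fun t x => pt f t x + c * pr f t x

/-- `D_{−,c} = ∂_t − c ∂_r`. -/
def Dm (c : ℝ) (f : Fn) : Fn := fun t x => pt f t x - c * pr f t x

/-- The seven fields `Z = {∂_t, ∂_1, ∂_2, ∂_3, Ω_{12}, Ω_{13}, Ω_{23}}`. -/
def Zop : Fin 7 → Fn → Fn :=
  ![pt, pd 0, pd 1, pd 2, rotA 0 1, rotA 0 2, rotA 1 2]

/-- `Z^α = Z_1^{α_1} ⋯ Z_7^{α_7}`. -/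
def Zpow (α : Fin 7 → ℕ) (f : Fn) : Fn :=
  (Zop 0)^[α 0] <| (Zop 1)^[α 1] <| (Zop 2)^[α 2] <| (Zop 3)^[α 3] <|
    (Zop 4)^[α 4] <| (Zop 5)^[α 5] <| (Zop 6)^[α 6] f

/-- Multi-indices `α` (for the seven fields) with `|α| ≤ s`. -/
def multiIdx (s : ℕ) : Finset (Fin 7 → ℕ) :=
  (Fintype.piFinset fun _ => Finset.range (s + 1)).filter fun α => ∑ i, α i ≤ s

/-- `|v(t,x)|_s = Σ_{|α| ≤ s} |Z^α v(t,x)|`. -/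
def vnorm (s : ℕ) (f : Fn) (t : ℝ) (x : E3) : ℝ :=
  ∑ α ∈ multiIdx s, |Zpow α f t x|

/-- Smoothness of a space-time function. -/
def Smooth (f : Fn) : Prop := ContDiff ℝ (⊤ : ℕ∞) (fun p : ℝ × E3 => f p.1 p.2)

/-- `u` is a smooth solution of `∂_t²u − c²Δu = G` on `(0,∞)×ℝ³`
with zero initial data. -/
def IsWaveSol (c : ℝ) (G u : Fn) : Prop :=
  Smooth u ∧
    (∀ t x, 0 < t → pt (pt u) t x - c ^ 2 * ∑ j, pd j (pd j u) t x = G t x) ∧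
    (∀ x, u 0 x = 0) ∧ (∀ x, pt u 0 x = 0)

/-- `u` is a smooth solution of the free wave equation `∂_t²u − c²Δu = 0`
on `(0,∞)×ℝ³` with initial data `φ, ψ`. -/
def IsFreeWaveSol (c : ℝ) (φ ψ : SFn) (u : Fn) : Prop :=
  Smooth u ∧
    (∀ t x, 0 < t → pt (pt u) t x - c ^ 2 * ∑ j, pd j (pd j u) t x = 0) ∧
    (∀ x, u 0 x = φ x) ∧ (∀ x, pt u 0 x = ψ x)

/-- Extension of the speeds `c_1, …, c_N` by `c_0 = 0`. -/
def cs0 {N : ℕ} (cs : Fin N → ℝ) : Fin (N + 1) → ℝ := Fin.cases 0 cs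

/-- The weight `w(t,r) = min_{0 ≤ j ≤ N} ⟨c_j t − r⟩` (with `c_0 = 0`). -/
def wgt {N : ℕ} (cs : Fin N → ℝ) (t r : ℝ) : ℝ :=
  Finset.univ.inf' Finset.univ_nonempty fun j : Fin (N + 1) => jb (cs0 cs j * t - r)

/-- The weighted sup `A_{ρ,μ,s}[G;c](t,x)` over the backward cone `Λ_c(t,x)`. -/
def Afun (ρ μ : ℝ) (s : ℕ) (G : Fn) (c : ℝ) {N : ℕ} (cs : Fin N → ℝ)
    (t : ℝ) (x : E3) : ℝ :=
  sSup {a : ℝ | ∃ τ : ℝ, ∃ y : E3, 0 ≤ τ ∧ τ ≤ t ∧ ‖y - x‖ ≤ c * (t - τ) ∧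
    a = ‖y‖ * jb (τ + ‖y‖) ^ ρ * wgt cs τ ‖y‖ ^ (1 + μ) * vnorm s G τ y}

/-- Spatial derivative of a function of `x` alone. -/
def sd (j : Fin 3) (φ : SFn) : SFn :=
  fun x => fderiv ℝ φ x (EuclideanSpace.single j 1)

/-- Spatial rotation field for functions of `x` alone. -/
def srot (j k : Fin 3) (φ : SFn) : SFn :=
  fun x => x j * sd k φ x - x k * sd j φ x

/-- The six spatial fields `{∂_1, ∂_2, ∂_3, Ω_{12}, Ω_{13}, Ω_{23}}`. -/
def Sop : Fin 6 → SFn → SFn :=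
  ![sd 0, sd 1, sd 2, srot 0 1, srot 0 2, srot 1 2]

/-- `Z^α` for the spatial fields. -/
def Spow (α : Fin 6 → ℕ) (φ : SFn) : SFn :=
  (Sop 0)^[α 0] <| (Sop 1)^[α 1] <| (Sop 2)^[α 2] <| (Sop 3)^[α 3] <|
    (Sop 4)^[α 4] <| (Sop 5)^[α 5] φ

/-- Spatial multi-indices with `|α| ≤ s`. -/
def smultiIdx (s : ℕ) : Finset (Fin 6 → ℕ) :=
  (Fintype.piFinset fun _ => Finset.range (s + 1)).filter fun α => ∑ i, α i ≤ s

/-- `|φ(x)|_s` for a function of `x` alone. -/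
def snorm (s : ℕ) (φ : SFn) (x : E3) : ℝ :=
  ∑ α ∈ smultiIdx s, |Spow α φ x|

/-- The weighted sup `B_{ρ,s}[φ,ψ;c](t,x)`. -/
def Bfun (ρ : ℝ) (s : ℕ) (φ ψ : SFn) (c t : ℝ) (x : E3) : ℝ :=
  sSup {b : ℝ | ∃ y : E3, ‖y - x‖ ≤ c * t ∧
    b = jb ‖y‖ ^ ρ * (snorm (s + 1) φ y + snorm s ψ y)}

/-- `Φ_ρ(t,r)`. -/
def Phi (ρ t r : ℝ) : ℝ :=
  if ρ = 0 then Real.log (2 + jb (t + r) / jb (t - r)) else jb (t - r) ^ (-ρ)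

/-- `Ψ_ρ(t)`. -/
def Psi (ρ t : ℝ) : ℝ := if ρ = 0 then Real.log (2 + t) else 1

/-- The null form `Q_0(v,w;c) = (∂_t v)(∂_t w) − c²(∇v)·(∇w)`. -/
def Q0f (c : ℝ) (v w : Fn) : Fn :=
  fun t x => pt v t x * pt w t x - c ^ 2 * ∑ j, pd j v t x * pd j w t x

/-- The null form `Q_{ab}(v,w) = (∂_a v)(∂_b w) − (∂_b v)(∂_a w)`. -/
def Qab (a b : Fin 4) (v w : Fn) : Fn :=
  fun t x => pda a v t x * pda b w t x - pda b v t x * pda a w t x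

/-- Lorentz boost `L_{c,j} = (x_j/c)∂_t + c t ∂_j`. -/
def Lb (c : ℝ) (j : Fin 3) (f : Fn) : Fn :=
  fun t x => (x j / c) * pt f t x + c * t * pd j f t x

/-- Scaling field `S = t ∂_t + x·∇_x`. -/
def Sc (f : Fn) : Fn := fun t x => t * pt f t x + ∑ j, x j * pd j f t x

/-- `v(t,r,ω) = r u(t, rω)`. -/
def Vrad (u : Fn) (ω : E3) (t r : ℝ) : ℝ := r * u t (r • ω)

/-- `(∂_t + ∂_r) v` in the variables `(t,r)` for fixed `ω`. -/
def DpV (u : Fn) (ω : E3) (t r : ℝ) : ℝ :=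
  deriv (fun s => Vrad u ω s r) t + deriv (fun ρ' => Vrad u ω t ρ') r

/-- Cross product in ℝ³. -/
def cross3 (a b : Fin 3 → ℝ) : Fin 3 → ℝ :=
  ![a 1 * b 2 - a 2 * b 1, a 2 * b 0 - a 0 * b 2, a 0 * b 1 - a 1 * b 0]

/-- `Ωv = (Ω_{23}v, −Ω_{13}v, Ω_{12}v)`. -/
def OmegaVec (v : Fn) (t : ℝ) (x : E3) : Fin 3 → ℝ :=
  ![rotA 1 2 v t x, -(rotA 0 2 v t x), rotA 0 1 v t x]

/-- `∂^α` for a multi-index with `|α| ≤ 1`: either the identity or a single `∂_a`. -/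
def Dle1 : Option (Fin 4) → Fn → Fn
  | none => id
  | some a => pda a

/-- A linear combination, with constant real coefficients, of the null forms
`Q_0(u_j, ∂^α u_k; c)` and `Q_{ab}(u_j, ∂^α u_k)` with `0 ≤ a < b ≤ 3`, `|α| ≤ 1`. -/
def NullF (c : ℝ) (m : ℕ)
    (a0 : Fin m → Fin m → Fin m → Option (Fin 4) → ℝ)
    (aQ : Fin m → Fin m → Fin m → Fin 4 → Fin 4 → Option (Fin 4) → ℝ)
    (v : Fin m → Fn) (i : Fin m) : Fn := fun t x =>
  (∑ j, ∑ k, ∑ o : Option (Fin 4), a0 i j k o * Q0f c (v j) (Dle1 o (v k)) t x) +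
    ∑ j, ∑ k, ∑ p ∈ Finset.univ.filter (fun p : Fin 4 × Fin 4 => p.1 < p.2),
      ∑ o : Option (Fin 4), aQ i j k p.1 p.2 o * Qab p.1 p.2 (v j) (Dle1 o (v k)) t x

/-- The standard basis vectors of `E3`. -/
abbrev ev (j : Fin 3) : E3 := EuclideanSpace.single j 1

theorem sum_smul_ev (y : E3) : y = ∑ j, y j • ev j := by
  ext i
  fin_cases i <;> simp [Fin.sum_univ_three]

theorem Smooth.hasFDerivAt {f : Fn} (hf : Smooth f) (p : ℝ × E3) :
    HasFDerivAt (fun p : ℝ × E3 => f p.1 p.2) (fderiv ℝ (fun p : ℝ × E3 => f p.1 p.2) p) p :=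
  (hf.differentiable (by simp) p).hasFDerivAt

theorem Smooth.pt_eq {f : Fn} (hf : Smooth f) (t : ℝ) (x : E3) :
    pt f t x = fderiv ℝ (fun p : ℝ × E3 => f p.1 p.2) (t, x) (1, 0) := by
  have h := (hf.hasFDerivAt (t, x)).comp_hasDerivAt t
    ((hasDerivAt_id t).prodMk (hasDerivAt_const t x))
  exact h.deriv

theorem Smooth.pd_eq {f : Fn} (hf : Smooth f) (j : Fin 3) (t : ℝ) (x : E3) :
    pd j f t x = fderiv ℝ (fun p : ℝ × E3 => f p.1 p.2) (t, x) (0, ev j) := by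
  have h := (hf.hasFDerivAt (t, x)).comp x
    ((hasFDerivAt_const t x).prodMk (hasFDerivAt_id x))
  have h2 : fderiv ℝ (f t) x = _ := h.fderiv
  unfold pd
  rw [h2]
  simp

theorem Smooth.fderiv_apply {f : Fn} (hf : Smooth f) (v : ℝ × E3) :
    ContDiff ℝ (⊤ : ℕ∞) (fun p => fderiv ℝ (fun p : ℝ × E3 => f p.1 p.2) p v) :=
  (ContDiff.fderiv_right (m := (⊤ : ℕ∞)) hf (by norm_cast)).clm_apply contDiff_const

theorem Smooth.pt {f : Fn} (hf : Smooth f) : Smooth (pt f) := by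
  have : (fun p : ℝ × E3 => PaperKatayama.pt f p.1 p.2) =
      fun p => fderiv ℝ (fun p : ℝ × E3 => f p.1 p.2) p (1, 0) := by
    funext p; exact hf.pt_eq p.1 p.2
  unfold Smooth
  rw [this]
  exact hf.fderiv_apply _

theorem Smooth.pd {f : Fn} (hf : Smooth f) (j : Fin 3) : Smooth (pd j f) := by
  have : (fun p : ℝ × E3 => PaperKatayama.pd j f p.1 p.2) =
      fun p => fderiv ℝ (fun p : ℝ × E3 => f p.1 p.2) p (0, ev j) := by
    funext p; exact hf.pd_eq j p.1 p.2
  unfold Smooth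
  rw [this]
  exact hf.fderiv_apply _

theorem Smooth.rotA {f : Fn} (hf : Smooth f) (j k : Fin 3) : Smooth (rotA j k f) := by
  have h1 := hf.pd j
  have h2 := hf.pd k
  unfold Smooth PaperKatayama.rotA at *
  fun_prop

theorem Smooth.continuous {f : Fn} (hf : Smooth f) :
    Continuous (fun p : ℝ × E3 => f p.1 p.2) := ContDiff.continuous hf

theorem Smooth.Zop {f : Fn} (hf : Smooth f) (i : Fin 7) : Smooth (Zop i f) := by
  fin_cases i
  · exact hf.pt
  · exact hf.pd 0
  · exact hf.pd 1
  · exact hf.pd 2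
  · exact hf.rotA 0 1
  · exact hf.rotA 0 2
  · exact hf.rotA 1 2

theorem Smooth.iterate {Z : Fn → Fn} (hZ : ∀ f, Smooth f → Smooth (Z f)) (n : ℕ) {f : Fn}
    (hf : Smooth f) : Smooth (Z^[n] f) := by
  induction n generalizing f with
  | zero => exact hf
  | succ n ih => exact ih (hZ f hf)

theorem Smooth.Zpow {f : Fn} (hf : Smooth f) (α : Fin 7 → ℕ) : Smooth (Zpow α f) := by
  have h : ∀ (i : Fin 7) (f : Fn), Smooth f → Smooth (PaperKatayama.Zop i f) :=
    fun i f hf => hf.Zop i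
  unfold PaperKatayama.Zpow
  exact (((((((hf.iterate (h 6) _).iterate (h 5) _).iterate (h 4) _).iterate (h 3) _).iterate
    (h 2) _).iterate (h 1) _).iterate (h 0) _)

/-- The chain rule along a space-time curve. -/
theorem Smooth.hasDerivAt_comp {f : Fn} (hf : Smooth f) {a : ℝ → ℝ} {b : ℝ → E3} {a' : ℝ}
    {b' : E3} {s : ℝ} (ha : HasDerivAt a a' s) (hb : HasDerivAt b b' s) :
    HasDerivAt (fun s => f (a s) (b s))
      (a' * PaperKatayama.pt f (a s) (b s) + ∑ j, b' j * PaperKatayama.pd j f (a s) (b s)) s := by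
  have h := (hf.hasFDerivAt (a s, b s)).comp_hasDerivAt s (ha.prodMk hb)
  have e : ((a', b') : ℝ × E3) = a' • ((1, 0) : ℝ × E3) + ∑ j, b' j • ((0, ev j) : ℝ × E3) := by
    ext i
    · simp [Prod.fst_sum]
    · rw [Prod.snd_add, Prod.snd_sum]
      simp only [Prod.smul_snd, smul_zero, zero_add]
      rw [← sum_smul_ev b']
  refine h.congr_deriv ?_
  rw [e, map_add, map_smul, map_sum, hf.pt_eq]
  congr 1
  refine Finset.sum_congr rfl fun j _ => ?_
  rw [map_smul, hf.pd_eq]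
  rfl

theorem Smooth.fderiv_comm {f : Fn} (hf : Smooth f) (p v w : ℝ × E3) :
    fderiv ℝ (fun q => fderiv ℝ (fun p : ℝ × E3 => f p.1 p.2) q v) p w =
      fderiv ℝ (fun q => fderiv ℝ (fun p : ℝ × E3 => f p.1 p.2) q w) p v := by
  have hd : DifferentiableAt ℝ (fderiv ℝ (fun p : ℝ × E3 => f p.1 p.2)) p :=
    (ContDiff.fderiv_right (m := (⊤ : ℕ∞)) hf (by norm_cast)).differentiable (by simp) p
  have key : ∀ v w : ℝ × E3, fderiv ℝ (fun q => fderiv ℝ (fun p : ℝ × E3 => f p.1 p.2) q v) p w =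
      fderiv ℝ (fderiv ℝ (fun p : ℝ × E3 => f p.1 p.2)) p w v := by
    intro v w
    rw [fderiv_clm_apply hd (differentiableAt_const v)]
    simp
  rw [key, key]
  have hs : IsSymmSndFDerivAt ℝ (fun p : ℝ × E3 => f p.1 p.2) p :=
    (ContDiff.contDiffAt hf).isSymmSndFDerivAt (by
      rw [minSmoothness_of_isRCLikeNormedField]; 
      exact WithTop.coe_le_coe.2 (le_top : (2 : ℕ∞) ≤ ⊤))
  exact hs w v

theorem Smooth.pt_pd_comm {f : Fn} (hf : Smooth f) (j : Fin 3) :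
    PaperKatayama.pt (PaperKatayama.pd j f) = PaperKatayama.pd j (PaperKatayama.pt f) := by
  funext t x
  rw [(hf.pd j).pt_eq, hf.pt.pd_eq]
  simp only [hf.pd_eq, hf.pt_eq]
  exact hf.fderiv_comm _ _ _

theorem Smooth.pd_pd_comm {f : Fn} (hf : Smooth f) (i j : Fin 3) :
    PaperKatayama.pd i (PaperKatayama.pd j f) = PaperKatayama.pd j (PaperKatayama.pd i f) := by
  funext t x
  rw [(hf.pd j).pd_eq, (hf.pd i).pd_eq]
  simp only [hf.pd_eq]
  exact hf.fderiv_comm _ _ _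

theorem hasDerivAt_line (x : E3) (j : Fin 3) (s : ℝ) :
    HasDerivAt (fun s : ℝ => x + s • ev j) (ev j) s := by
  simpa using ((hasDerivAt_id s).smul_const (ev j)).const_add x

theorem pd_eq_deriv {f : Fn} (hf : Smooth f) (j : Fin 3) (t : ℝ) (x : E3) :
    pd j f t x = deriv (fun s : ℝ => f t (x + s • ev j)) 0 := by
  have h := hf.hasDerivAt_comp (hasDerivAt_const (0:ℝ) t) (hasDerivAt_line x j 0)
  rw [h.deriv]
  fin_cases j <;> simp

theorem pd_of_hasDerivAt {f : Fn} (hf : Smooth f) {j : Fin 3} {t : ℝ} {x : E3} {a : ℝ}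
    (h : HasDerivAt (fun s : ℝ => f t (x + s • ev j)) a 0) : pd j f t x = a := by
  rw [pd_eq_deriv hf, h.deriv]

theorem hasDerivAt_pd {f : Fn} (hf : Smooth f) (j : Fin 3) (t : ℝ) (x : E3) :
    HasDerivAt (fun s : ℝ => f t (x + s • ev j)) (pd j f t x) 0 := by
  have h := hf.hasDerivAt_comp (hasDerivAt_const (0:ℝ) t) (hasDerivAt_line x j 0)
  rw [pd_eq_deriv hf]
  exact h.differentiableAt.hasDerivAt

theorem hasDerivAt_pt {f : Fn} (hf : Smooth f) (t : ℝ) (x : E3) :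
    HasDerivAt (fun s : ℝ => f s x) (pt f t x) t := by
  have h := hf.hasDerivAt_comp (hasDerivAt_id t) (hasDerivAt_const t x)
  exact h.differentiableAt.hasDerivAt

/-- A spatial derivative of a rotation field applied to `f`. -/
theorem pd_rotA {f : Fn} (hf : Smooth f) (i j k : Fin 3) (t : ℝ) (x : E3) :
    pd i (rotA j k f) t x =
      (ev i j) * pd k f t x + x j * pd i (pd k f) t x -
        ((ev i k) * pd j f t x + x k * pd i (pd j f) t x) := by
  apply pd_of_hasDerivAt (hf.rotA j k)
  unfold rotA
  have hc : ∀ l, HasDerivAt (fun s : ℝ => (x + s • ev i) l) (ev i l) 0 := by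
    intro l
    have := ((hasDerivAt_id (0:ℝ)).mul_const (ev i l)).const_add (x l)
    simpa using this
  have := ((hc j).mul (hasDerivAt_pd (hf.pd k) i t x)).sub
    ((hc k).mul (hasDerivAt_pd (hf.pd j) i t x))
  exact this.congr_deriv (by simp)

theorem pt_rotA {f : Fn} (hf : Smooth f) (j k : Fin 3) :
    pt (rotA j k f) = rotA j k (pt f) := by
  funext t x
  have := ((hasDerivAt_pt (hf.pd k) t x).const_mul (x j)).sub
    ((hasDerivAt_pt (hf.pd j) t x).const_mul (x k))
  have h2 : pt (rotA j k f) t x = _ := this.deriv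
  rw [h2, hf.pt_pd_comm, hf.pt_pd_comm]
  rfl

/-- The sum of the squared rotation fields in Cartesian coordinates. -/
theorem sum_rotA_sq {f : Fn} (hf : Smooth f) (t : ℝ) (x : E3) :
    rotA 0 1 (rotA 0 1 f) t x + rotA 0 2 (rotA 0 2 f) t x + rotA 1 2 (rotA 1 2 f) t x =
      (∑ j, x j ^ 2) * ∑ j, pd j (pd j f) t x - (∑ i, ∑ j, x i * x j * pd i (pd j f) t x)
        - 2 * ∑ j, x j * pd j f t x := by
  have e : ∀ j k (g : Fn), rotA j k g t x = x j * pd k g t x - x k * pd j g t x :=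
    fun _ _ _ => rfl
  simp only [e _ _ (rotA _ _ _), pd_rotA hf, Fin.sum_univ_three]
  rw [hf.pd_pd_comm 1 0, hf.pd_pd_comm 2 0, hf.pd_pd_comm 2 1]
  simp
  ring

/-- The Laplacian of a space-time function. -/
def lap (f : Fn) : Fn := fun t x => ∑ j, pd j (pd j f) t x

theorem Smooth.lap {f : Fn} (hf : Smooth f) : Smooth (lap f) := by
  have h := fun j => (hf.pd j).pd j
  unfold Smooth PaperKatayama.lap at *
  fun_prop

theorem rotA_add_mul {f g : Fn} (hf : Smooth f) (hg : Smooth g) (a : ℝ) (j k : Fin 3) :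
    rotA j k (fun t x => f t x - a * g t x) = fun t x => rotA j k f t x - a * rotA j k g t x := by
  have hs : Smooth (fun t x => f t x - a * g t x) := by
    unfold Smooth at *; fun_prop
  have : ∀ i t x, pd i (fun t x => f t x - a * g t x) t x = pd i f t x - a * pd i g t x := by
    intro i t x
    exact pd_of_hasDerivAt hs ((hasDerivAt_pd hf i t x).sub ((hasDerivAt_pd hg i t x).const_mul a))
  funext t x
  simp only [rotA, this]
  ring

/-- The wave operator `∂_t² − c²Δ`. -/
def box (c : ℝ) (f : Fn) : Fn := fun t x => pt (pt f) t x - c ^ 2 * lap f t x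

theorem Smooth.box {f : Fn} (hf : Smooth f) (c : ℝ) : Smooth (box c f) := by
  have h := hf.pt.pt
  have h' := hf.lap
  unfold Smooth PaperKatayama.box at *
  fun_prop

theorem pd_lap {f : Fn} (hf : Smooth f) (i : Fin 3) : pd i (lap f) = lap (pd i f) := by
  funext t x
  have h : ∀ j, HasDerivAt (fun s : ℝ => pd j (pd j f) t (x + s • ev i))
      (pd j (pd j (pd i f)) t x) 0 := by
    intro j
    have := hasDerivAt_pd ((hf.pd j).pd j) i t x
    rwa [(hf.pd j).pd_pd_comm i j, hf.pd_pd_comm i j] at this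
  exact pd_of_hasDerivAt hf.lap (HasDerivAt.fun_sum fun j _ => h j)

theorem pt_lap {f : Fn} (hf : Smooth f) : pt (lap f) = lap (pt f) := by
  funext t x
  have h : ∀ j, HasDerivAt (fun s : ℝ => pd j (pd j f) s x)
      (pd j (pd j (pt f)) t x) t := by
    intro j
    have := hasDerivAt_pt ((hf.pd j).pd j) t x
    rwa [(hf.pd j).pt_pd_comm j, hf.pt_pd_comm j] at this
  exact (HasDerivAt.fun_sum fun j _ => h j).deriv

theorem box_pd {f : Fn} (hf : Smooth f) (c : ℝ) (i : Fin 3) :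
    box c (pd i f) = pd i (box c f) := by
  funext t x
  symm
  apply pd_of_hasDerivAt (hf.box c)
  have h := (hasDerivAt_pd hf.pt.pt i t x).sub ((hasDerivAt_pd hf.lap i t x).const_mul (c ^ 2))
  rwa [← hf.pt.pt_pd_comm, ← hf.pt_pd_comm, pd_lap hf] at h

theorem box_pt {f : Fn} (hf : Smooth f) (c : ℝ) :
    box c (pt f) = pt (box c f) := by
  funext t x
  symm
  have h := (hasDerivAt_pt hf.pt.pt t x).sub ((hasDerivAt_pt hf.lap t x).const_mul (c ^ 2))
  rw [pt_lap hf] at h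
  exact h.deriv

theorem lap_rotA {f : Fn} (hf : Smooth f) (j k : Fin 3) (hjk : j ≠ k) :
    lap (rotA j k f) = rotA j k (lap f) := by
  funext t x
  have e : rotA j k (lap f) t x = x j * pd k (lap f) t x - x k * pd j (lap f) t x := rfl
  rw [e, pd_lap hf, pd_lap hf]
  have h : ∀ i, pd i (pd i (rotA j k f)) t x =
      2 * ev i j * pd i (pd k f) t x + x j * pd i (pd i (pd k f)) t x -
        (2 * ev i k * pd i (pd j f) t x + x k * pd i (pd i (pd j f)) t x) := by
    intro i
    apply pd_of_hasDerivAt ((hf.rotA j k).pd i)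
    have hc : ∀ l, HasDerivAt (fun s : ℝ => (x + s • ev i) l) (ev i l) 0 := by
      intro l
      have := ((hasDerivAt_id (0:ℝ)).mul_const (ev i l)).const_add (x l)
      simpa using this
    simp only [pd_rotA hf]
    have := (((hasDerivAt_pd (hf.pd k) i t x).const_mul (ev i j)).add
      ((hc j).mul (hasDerivAt_pd ((hf.pd k).pd i) i t x))).sub
      (((hasDerivAt_pd (hf.pd j) i t x).const_mul (ev i k)).add
      ((hc k).mul (hasDerivAt_pd ((hf.pd j).pd i) i t x)))
    refine this.congr_deriv ?_
    simp only [zero_smul, add_zero]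
    ring
  simp only [lap, h, Fin.sum_univ_three]
  fin_cases j <;> fin_cases k <;> simp at hjk ⊢
  · rw [hf.pd_pd_comm 1 0]; ring
  · rw [hf.pd_pd_comm 2 0]; ring
  · rw [hf.pd_pd_comm 1 0]; ring
  · rw [hf.pd_pd_comm 2 1]; ring
  · rw [hf.pd_pd_comm 2 0]; ring
  · rw [hf.pd_pd_comm 2 1]; ring

theorem box_rotA {f : Fn} (hf : Smooth f) (c : ℝ) (j k : Fin 3) (hjk : j ≠ k) :
    box c (rotA j k f) = rotA j k (box c f) := by
  unfold box
  rw [pt_rotA hf, pt_rotA hf.pt, lap_rotA hf j k hjk, rotA_add_mul hf.pt.pt hf.lap]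

/-- Composition with a rigid motion of space. -/
def rigid (x : E3) (R : E3 ≃ₗᵢ[ℝ] E3) (f : Fn) : Fn := fun t y => f t (x + R y)

theorem Smooth.rigid {f : Fn} (hf : Smooth f) (x : E3) (R : E3 ≃ₗᵢ[ℝ] E3) :
    Smooth (rigid x R f) := by
  have h : ContDiff ℝ (⊤ : ℕ∞) (fun p : ℝ × E3 => (p.1, x + R p.2)) :=
    contDiff_fst.prodMk (contDiff_const.add (R.contDiff.comp contDiff_snd))
  exact ContDiff.comp hf h

theorem pd_rigid {f : Fn} (hf : Smooth f) (x : E3) (R : E3 ≃ₗᵢ[ℝ] E3) (j : Fin 3) (t : ℝ)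
    (y : E3) : pd j (rigid x R f) t y = ∑ k, R (ev j) k * pd k f t (x + R y) := by
  apply pd_of_hasDerivAt (hf.rigid x R)
  have hb : HasDerivAt (fun s : ℝ => x + R (y + s • ev j)) (R (ev j)) 0 := by
    have : HasDerivAt (fun s : ℝ => (x + R y) + s • R (ev j)) (R (ev j)) 0 := by
      simpa using ((hasDerivAt_id (0:ℝ)).smul_const (R (ev j))).const_add (x + R y)
    refine this.congr_of_eventuallyEq (Filter.Eventually.of_forall fun s => ?_)
    simp [add_assoc]
  have h := hf.hasDerivAt_comp (hasDerivAt_const (0:ℝ) t) hb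
  simpa [rigid] using h

theorem lap_rigid {f : Fn} (hf : Smooth f) (x : E3) (R : E3 ≃ₗᵢ[ℝ] E3) :
    lap (rigid x R f) = rigid x R (lap f) := by
  funext t y
  have h : ∀ j, pd j (pd j (rigid x R f)) t y =
      ∑ k, ∑ l, R (ev j) k * R (ev j) l * pd l (pd k f) t (x + R y) := by
    intro j
    apply pd_of_hasDerivAt ((hf.rigid x R).pd j)
    simp only [pd_rigid hf]
    refine HasDerivAt.fun_sum fun k _ => ?_
    have := (hasDerivAt_pd ((hf.pd k).rigid x R) j t y).const_mul (R (ev j) k)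
    rw [pd_rigid (hf.pd k), Finset.mul_sum] at this
    refine this.congr_deriv (Finset.sum_congr rfl fun l _ => by ring)
  have horth : ∀ k l, ∑ j, R (ev j) k * R (ev j) l = if k = l then 1 else 0 := by
    intro k l
    have := ((EuclideanSpace.basisFun (Fin 3) ℝ).map R).sum_inner_mul_inner (ev k) (ev l)
    simp only [OrthonormalBasis.map_apply, EuclideanSpace.basisFun_apply,
      EuclideanSpace.inner_single_left, EuclideanSpace.inner_single_right] at this
    simp at this
    simpa [eq_comm] using this
  calc lap (rigid x R f) t y
      = ∑ j, ∑ k, ∑ l, R (ev j) k * R (ev j) l * pd l (pd k f) t (x + R y) :=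
        Finset.sum_congr rfl fun j _ => h j
    _ = ∑ k, ∑ l, (∑ j, R (ev j) k * R (ev j) l) * pd l (pd k f) t (x + R y) := by
        rw [Finset.sum_comm]
        refine Finset.sum_congr rfl fun k _ => ?_
        rw [Finset.sum_comm]
        refine Finset.sum_congr rfl fun l _ => ?_
        rw [Finset.sum_mul]
    _ = rigid x R (lap f) t y := by
        simp [horth, rigid, lap]

theorem integral_swap_of_continuous {F : ℝ → ℝ → ℝ} (hF : Continuous (Function.uncurry F))
    (a b c d : ℝ) :
    (∫ x in a..b, ∫ y in c..d, F x y) = ∫ y in c..d, ∫ x in a..b, F x y := by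
  apply MeasureTheory.intervalIntegral_intervalIntegral_swap
  exact (hF.continuousOn.integrableOn_compact (μ := MeasureTheory.volume)
    (isCompact_uIcc.prod isCompact_uIcc)).mono_set
    (Set.prod_mono Set.uIoc_subset_uIcc Set.uIoc_subset_uIcc)

theorem integral_rotate_of_continuous {F : ℝ → ℝ → ℝ → ℝ}
    (hF : Continuous fun q : ℝ × ℝ × ℝ => F q.1 q.2.1 q.2.2) (a b c d e f : ℝ) :
    (∫ x in a..b, ∫ y in c..d, ∫ z in e..f, F x y z) =
      ∫ z in e..f, ∫ x in a..b, ∫ y in c..d, F x y z := by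
  have h1 : ∀ x, Continuous (Function.uncurry (F x)) := fun x =>
    hF.comp (Continuous.prodMk_right x)
  have h2 : Continuous (Function.uncurry fun x z => ∫ y in c..d, F x y z) := by
    apply intervalIntegral.continuous_parametric_intervalIntegral_of_continuous'
      (f := fun (p : ℝ × ℝ) y => F p.1 y p.2)
    have hm : Continuous fun r : (ℝ × ℝ) × ℝ => (r.1.1, r.2, r.1.2) := by fun_prop
    exact hF.comp hm
  rw [← integral_swap_of_continuous h2]
  congr 1
  funext x
  exact integral_swap_of_continuous (h1 x) _ _ _ _

/-- The unit vector with polar angle `φ` and azimuth `θ`. -/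
def om (φ θ : ℝ) : E3 :=
  !₂[Real.sin φ * Real.cos θ, Real.sin φ * Real.sin θ, Real.cos φ]

@[simp] theorem om_zero (φ θ : ℝ) : om φ θ 0 = Real.sin φ * Real.cos θ := rfl
@[simp] theorem om_one (φ θ : ℝ) : om φ θ 1 = Real.sin φ * Real.sin θ := rfl
@[simp] theorem om_two (φ θ : ℝ) : om φ θ 2 = Real.cos φ := rfl

theorem continuous_om : Continuous (fun p : ℝ × ℝ => om p.1 p.2) := by
  refine (PiLp.continuous_toLp 2 _).comp (continuous_pi fun i => ?_)
  fin_cases i <;> simp <;> fun_prop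

theorem sum_sq_om (φ θ : ℝ) : ∑ j, om φ θ j ^ 2 = 1 := by
  simp only [Fin.sum_univ_three, om_zero, om_one, om_two]
  have h1 := Real.sin_sq_add_cos_sq φ
  have h2 := Real.sin_sq_add_cos_sq θ
  linear_combination h1 + (Real.sin φ) ^ 2 * h2

theorem norm_om (φ θ : ℝ) : ‖om φ θ‖ = 1 := by
  rw [EuclideanSpace.norm_eq]
  simp only [Real.norm_eq_abs, sq_abs, sum_sq_om, Real.sqrt_one]

theorem hasDerivAt_e3 {a b c : ℝ → ℝ} {a' b' c' s : ℝ} (ha : HasDerivAt a a' s)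
    (hb : HasDerivAt b b' s) (hc : HasDerivAt c c' s) :
    HasDerivAt (fun s => (!₂[a s, b s, c s] : E3)) !₂[a', b', c'] s := by
  have h := ((ha.smul_const (ev 0)).add (hb.smul_const (ev 1))).add (hc.smul_const (ev 2))
  convert! h using 1
  · funext s; ext i; fin_cases i <;> simp
  · ext i; fin_cases i <;> simp

theorem hasDerivAt_om_left (φ θ : ℝ) : HasDerivAt (fun φ => om φ θ)
    !₂[Real.cos φ * Real.cos θ, Real.cos φ * Real.sin θ, -Real.sin φ] φ :=
  hasDerivAt_e3 ((Real.hasDerivAt_sin φ).mul_const _) ((Real.hasDerivAt_sin φ).mul_const _)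
    (Real.hasDerivAt_cos φ)

theorem hasDerivAt_om_right (φ θ : ℝ) : HasDerivAt (fun θ => om φ θ)
    !₂[Real.sin φ * -Real.sin θ, Real.sin φ * Real.cos θ, 0] θ :=
  hasDerivAt_e3 ((Real.hasDerivAt_cos θ).const_mul _) ((Real.hasDerivAt_sin θ).const_mul _)
    (hasDerivAt_const _ _)

/-- The integral over the unit sphere of `ω ↦ g (s • ω)`. -/
def sphInt (g : E3 → ℝ) (s : ℝ) : ℝ :=
  ∫ φ in (0:ℝ)..Real.pi, ∫ θ in (0:ℝ)..(2 * Real.pi), Real.sin φ * g (s • om φ θ)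

/-- The integral of a divergence over the parameter rectangle vanishes. -/
theorem integral_div_eq_zero {A B a b : ℝ → ℝ → ℝ}
    (hA : ∀ φ θ, HasDerivAt (fun φ => A φ θ) (a φ θ) φ)
    (hB : ∀ φ θ, HasDerivAt (fun θ => B φ θ) (b φ θ) θ)
    (ha : Continuous (Function.uncurry a)) (hb : Continuous (Function.uncurry b))
    (hA0 : ∀ θ, A 0 θ = 0) (hA1 : ∀ θ, A Real.pi θ = 0) (hB0 : ∀ φ, B φ (2 * Real.pi) = B φ 0) :
    (∫ φ in (0:ℝ)..Real.pi, ∫ θ in (0:ℝ)..(2 * Real.pi), (a φ θ + b φ θ)) = 0 := by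
  have ha1 : ∀ φ, Continuous (a φ) := fun φ => ha.comp (Continuous.prodMk_right φ)
  have ha2 : ∀ θ, Continuous (fun φ => a φ θ) := fun θ => ha.comp (Continuous.prodMk_left θ)
  have hb1 : ∀ φ, Continuous (b φ) := fun φ => hb.comp (Continuous.prodMk_right φ)
  have e : ∀ φ, (∫ θ in (0:ℝ)..(2 * Real.pi), (a φ θ + b φ θ)) =
      ∫ θ in (0:ℝ)..(2 * Real.pi), a φ θ := by
    intro φ
    rw [intervalIntegral.integral_add ((ha1 φ).intervalIntegrable _ _)
      ((hb1 φ).intervalIntegrable _ _),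
      intervalIntegral.integral_eq_sub_of_hasDerivAt (fun θ _ => hB φ θ)
        ((hb1 φ).intervalIntegrable _ _), hB0]
    ring
  simp only [e]
  rw [integral_swap_of_continuous ha]
  have e2 : ∀ θ, (∫ φ in (0:ℝ)..Real.pi, a φ θ) = 0 := by
    intro θ
    rw [intervalIntegral.integral_eq_sub_of_hasDerivAt (fun φ _ => hA φ θ)
        ((ha2 θ).intervalIntegrable _ _), hA0, hA1]
    ring
  simp [e2]

theorem Smooth.continuous_right {f : Fn} (hf : Smooth f) (t : ℝ) : Continuous (f t) :=
  hf.continuous.comp (Continuous.prodMk_right t)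

/-- Rotation fields have zero spherical mean. -/
theorem sphInt_rotA {f : Fn} (hf : Smooth f) (t s : ℝ) {j k : Fin 3} (hjk : j < k) :
    sphInt (rotA j k f t) s = 0 := by
  have d1 : ∀ φ θ, HasDerivAt (fun φ => f t (s • om φ θ)) _ φ := fun φ θ =>
    hf.hasDerivAt_comp (hasDerivAt_const φ t) ((hasDerivAt_om_left φ θ).const_smul s)
  have d2 : ∀ φ θ, HasDerivAt (fun θ => f t (s • om φ θ)) _ θ := fun φ θ =>
    hf.hasDerivAt_comp (hasDerivAt_const θ t) ((hasDerivAt_om_right φ θ).const_smul s)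
  simp only [Fin.sum_univ_three] at d1 d2
  have hcases : (j = 0 ∧ k = 1) ∨ (j = 0 ∧ k = 2) ∨ (j = 1 ∧ k = 2) := by
    revert j k; decide
  unfold sphInt
  have h0 := (hf.pd 0).continuous_right t
  have h1 := (hf.pd 1).continuous_right t
  have h2 := (hf.pd 2).continuous_right t
  have hft := hf.continuous_right t
  have hom := continuous_om
  rcases hcases with ⟨rfl, rfl⟩ | ⟨rfl, rfl⟩ | ⟨rfl, rfl⟩
  · have key := integral_div_eq_zero (A := fun _ _ => 0) (a := fun _ _ => 0)
      (B := fun φ θ => Real.sin φ * f t (s • om φ θ))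
      (fun φ θ => hasDerivAt_const _ _) (fun φ θ => (d2 φ θ).const_mul (Real.sin φ))
      continuous_const (by simp [Function.uncurry_def]; fun_prop) (fun _ => rfl) (fun _ => rfl)
      (fun φ => by simp [om])
    rw [← key]
    congr 1
    funext φ
    congr 1
    funext θ
    simp [rotA]
    left
    ring
  · have key := integral_div_eq_zero
      (A := fun φ θ => -(Real.sin φ * Real.cos θ) * f t (s • om φ θ))
      (B := fun φ θ => (Real.cos φ * Real.sin θ) * f t (s • om φ θ))
      (fun φ θ => (((Real.hasDerivAt_sin φ).mul_const (Real.cos θ)).fun_neg).mul (d1 φ θ))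
      (fun φ θ => ((Real.hasDerivAt_sin θ).const_mul (Real.cos φ)).mul (d2 φ θ))
      (by simp [Function.uncurry_def]; fun_prop) (by simp [Function.uncurry_def]; fun_prop)
      (fun _ => by simp) (fun _ => by simp) (fun φ => by simp [om])
    rw [← key]
    congr 1
    funext φ
    congr 1
    funext θ
    have := Real.sin_sq_add_cos_sq θ
    simp [rotA]
    linear_combination (s * (Real.sin φ * Real.cos φ * (pd 0 f t (s • om φ θ)))) * this
  · have key := integral_div_eq_zero
      (A := fun φ θ => -(Real.sin φ * Real.sin θ) * f t (s • om φ θ))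
      (B := fun φ θ => -(Real.cos φ * Real.cos θ) * f t (s • om φ θ))
      (fun φ θ => (((Real.hasDerivAt_sin φ).mul_const (Real.sin θ)).fun_neg).mul (d1 φ θ))
      (fun φ θ => (((Real.hasDerivAt_cos θ).const_mul (Real.cos φ)).fun_neg).mul (d2 φ θ))
      (by simp [Function.uncurry_def]; fun_prop) (by simp [Function.uncurry_def]; fun_prop)
      (fun _ => by simp) (fun _ => by simp) (fun φ => by simp [om])
    rw [← key]
    congr 1
    funext φ
    congr 1
    funext θ
    have := Real.sin_sq_add_cos_sq θ
    simp [rotA]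
    linear_combination (s * (Real.sin φ * Real.cos φ * (pd 1 f t (s • om φ θ)))) * this

/-- The derivative of `∂_- (r u)` along an incoming radial characteristic. -/
def rayDeriv (c : ℝ) (u : Fn) (ω : E3) (t s : ℝ) : ℝ :=
  s * (pt (pt u) t (s • ω) - c ^ 2 * ∑ i, ∑ j, ω i * ω j * pd i (pd j u) t (s • ω))
    - 2 * c ^ 2 * ∑ j, ω j * pd j u t (s • ω)

/-- `(∂_t + c ∂_r)(r u)` in the direction `ω`. -/
def rayVal (c : ℝ) (u : Fn) (ω : E3) (t s : ℝ) : ℝ :=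
  c * u t (s • ω) + s * (pt u t (s • ω) + c * ∑ j, ω j * pd j u t (s • ω))

theorem hasDerivAt_rayVal {u : Fn} (hu : Smooth u) (c m : ℝ) (ω : E3) (τ : ℝ) :
    HasDerivAt (fun τ => rayVal c u ω τ (m - c * τ)) (rayDeriv c u ω τ (m - c * τ)) τ := by
  have hs : HasDerivAt (fun τ => m - c * τ) (-c) τ := by
    simpa using ((hasDerivAt_id τ).const_mul c).const_sub m
  have h : ∀ f, Smooth f → HasDerivAt (fun τ => f τ ((m - c * τ) • ω)) _ τ := fun f hf =>
    hf.hasDerivAt_comp (hasDerivAt_id τ) (hs.smul_const ω)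
  have key := ((h u hu).const_mul c).add (hs.mul ((h _ hu.pt).add
    ((HasDerivAt.fun_sum (u := Finset.univ)
      fun j _ => (h _ (hu.pd j)).const_mul (ω j)).const_mul c)))
  refine key.congr_deriv ?_
  simp only [rayDeriv, Pi.add_apply, Fin.sum_univ_three, PiLp.smul_apply, smul_eq_mul, hu.pt_pd_comm]
  ring

theorem rayDeriv_eq {u : Fn} (hu : Smooth u) (c : ℝ) {ω : E3} (hω : ∑ j, ω j ^ 2 = 1) (t s : ℝ)
    (hs : s ≠ 0) :
    rayDeriv c u ω t s = s * box c u t (s • ω) + c ^ 2 * s⁻¹ *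
      (rotA 0 1 (rotA 0 1 u) t (s • ω) + rotA 0 2 (rotA 0 2 u) t (s • ω)
        + rotA 1 2 (rotA 1 2 u) t (s • ω)) := by
  rw [sum_rotA_sq hu]
  simp only [rayDeriv, box, lap, PiLp.smul_apply, smul_eq_mul, mul_pow, ← Finset.mul_sum, hω]
  have : ∑ x, ∑ i, s * ω x * (s * ω i) * pd x (pd i u) t (s • ω) =
      s ^ 2 * ∑ x, ∑ i, ω x * ω i * pd x (pd i u) t (s • ω) := by
    simp only [Finset.mul_sum]
    refine Finset.sum_congr rfl fun i _ => Finset.sum_congr rfl fun j _ => by ring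
  rw [this]
  have : ∑ i, s * ω i * pd i u t (s • ω) = s * ∑ i, ω i * pd i u t (s • ω) := by
    simp only [Finset.mul_sum]
    refine Finset.sum_congr rfl fun i _ => by ring
  rw [this]
  field_simp
  ring

theorem sphInt_add_const_mul {f g h k : E3 → ℝ} (a b s : ℝ) (hf : Continuous f)
    (hg : Continuous g) (hh : Continuous h) (hk : Continuous k) :
    sphInt (fun y => a * f y + b * (g y + h y + k y)) s =
      a * sphInt f s + b * (sphInt g s + sphInt h s + sphInt k s) := by
  have hc : ∀ {f : E3 → ℝ}, Continuous f →
      Continuous (Function.uncurry fun φ θ => Real.sin φ * f (s • om φ θ)) := fun hf =>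
    (Real.continuous_sin.comp continuous_fst).mul (hf.comp (continuous_om.const_smul s))
  have hi : ∀ {f : E3 → ℝ}, Continuous f → ∀ φ, IntervalIntegrable
      (fun θ => Real.sin φ * f (s • om φ θ)) MeasureTheory.volume 0 (2 * Real.pi) :=
    fun hf φ => ((hc hf).comp (Continuous.prodMk_right φ)).intervalIntegrable _ _
  have ho : ∀ {f : E3 → ℝ}, Continuous f → IntervalIntegrable
      (fun φ => ∫ θ in (0:ℝ)..(2 * Real.pi), Real.sin φ * f (s • om φ θ))
      MeasureTheory.volume 0 Real.pi :=
    fun hf => (intervalIntegral.continuous_parametric_intervalIntegral_of_continuous' (hc hf)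
      _ _).intervalIntegrable _ _
  have add : ∀ {f g : E3 → ℝ}, Continuous f → Continuous g →
      sphInt (fun y => f y + g y) s = sphInt f s + sphInt g s := by
    intro f g hf hg
    unfold sphInt
    rw [← intervalIntegral.integral_add (ho hf) (ho hg)]
    refine intervalIntegral.integral_congr fun φ _ => ?_
    simp only
    rw [← intervalIntegral.integral_add (hi hf φ) (hi hg φ)]
    simp only [mul_add]
  have mul : ∀ (a : ℝ) (f : E3 → ℝ), sphInt (fun y => a * f y) s = a * sphInt f s := by
    intro a f
    unfold sphInt
    simp only [← intervalIntegral.integral_const_mul]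
    simp only [mul_left_comm]
  rw [add (by fun_prop) (by fun_prop), mul, mul, add (by fun_prop) hk, add hg hh]

theorem continuous_rayDeriv {u : Fn} (hu : Smooth u) (c m : ℝ) :
    Continuous fun p : ℝ × E3 => rayDeriv c u p.2 p.1 (m - c * p.1) := by
  have hq : Continuous fun p : ℝ × E3 => (p.1, (m - c * p.1) • p.2) := by fun_prop
  have h : ∀ f, Smooth f → Continuous fun p : ℝ × E3 => f p.1 ((m - c * p.1) • p.2) :=
    fun f hf => hf.continuous.comp hq
  have h0 := h _ hu.pt.pt
  have h1 := fun j => h _ (hu.pd j)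
  have h2 := fun i j => h _ ((hu.pd j).pd i)
  have h3 : ∀ j : Fin 3, Continuous fun p : ℝ × E3 => p.2 j := fun j => by fun_prop
  unfold rayDeriv
  refine ((continuous_const.sub (continuous_const.mul continuous_fst)).mul (h0.sub
    (continuous_const.mul (continuous_finsetSum _ fun i _ => continuous_finsetSum _ fun j _ =>
      ((h3 i).mul (h3 j)).mul (h2 i j))))).sub (continuous_const.mul
      (continuous_finsetSum _ fun j _ => (h3 j).mul (h1 j)))

theorem integral_rayDeriv {u : Fn} (hu : Smooth u) (c m : ℝ) (ω : E3) (t : ℝ)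
    (h0 : ∀ x, u 0 x = 0) :
    (∫ τ in (0:ℝ)..t, rayDeriv c u ω τ (m - c * τ)) =
      rayVal c u ω t (m - c * t) - m * pt u 0 (m • ω) := by
  rw [intervalIntegral.integral_eq_sub_of_hasDerivAt
    (fun τ _ => hasDerivAt_rayVal hu c m ω τ)
    (((continuous_rayDeriv hu c m).comp (Continuous.prodMk_left ω)).intervalIntegrable _ _)]
  have hp : ∀ j x, pd j u 0 x = 0 := by
    intro j x
    exact pd_of_hasDerivAt hu (by simp only [h0]; exact hasDerivAt_const _ _)
  simp [rayVal, h0, hp]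

theorem sphInt_const (a s : ℝ) : sphInt (fun _ => a) s = 4 * Real.pi * a := by
  unfold sphInt
  simp only [intervalIntegral.integral_const, smul_eq_mul, intervalIntegral.integral_const_mul,
    intervalIntegral.integral_mul_const, integral_sin, Real.cos_zero, Real.cos_pi]
  ring

/-- Kirchhoff's formula at the origin. -/
theorem kirchhoff {u : Fn} (hu : Smooth u) (c : ℝ) (hc : c ≠ 0) (t : ℝ)
    (h0 : ∀ x, u 0 x = 0) :
    4 * Real.pi * c * u t 0 = c * t * sphInt (pt u 0) (c * t) +
      ∫ τ in (0:ℝ)..t, (c * t - c * τ) * sphInt (box c u τ) (c * t - c * τ) := by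
  have hD : Continuous fun q : ℝ × ℝ × ℝ =>
      Real.sin q.1 * rayDeriv c u (om q.1 q.2.1) q.2.2 (c * t - c * q.2.2) :=
    (Real.continuous_sin.comp continuous_fst).mul
      ((continuous_rayDeriv hu c (c * t)).comp ((continuous_snd.comp continuous_snd).prodMk
        (continuous_om.comp (continuous_fst.prodMk (continuous_fst.comp continuous_snd)))))
  have e1 : (∫ φ in (0:ℝ)..Real.pi, ∫ θ in (0:ℝ)..(2 * Real.pi), ∫ τ in (0:ℝ)..t,
      Real.sin φ * rayDeriv c u (om φ θ) τ (c * t - c * τ)) =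
      4 * Real.pi * c * u t 0 - c * t * sphInt (pt u 0) (c * t) := by
    have := sphInt_add_const_mul (f := fun _ => c * u t 0) (g := pt u 0) (h := fun _ => 0)
      (k := fun _ => 0) 1 (-(c * t)) (c * t) continuous_const (hu.pt.continuous_right 0)
      continuous_const continuous_const
    rw [sphInt_const, sphInt_const] at this
    calc _ = sphInt (fun y => 1 * (c * u t 0) + -(c * t) * (pt u 0 y + 0 + 0)) (c * t) := by
          unfold sphInt
          congr 1
          funext φ
          congr 1
          funext θ
          rw [intervalIntegral.integral_const_mul, integral_rayDeriv hu c (c * t) _ t h0]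
          simp [rayVal]
          left
          ring
      _ = _ := by rw [this]; ring
  have e2 : (∫ φ in (0:ℝ)..Real.pi, ∫ θ in (0:ℝ)..(2 * Real.pi), ∫ τ in (0:ℝ)..t,
      Real.sin φ * rayDeriv c u (om φ θ) τ (c * t - c * τ)) =
      ∫ τ in (0:ℝ)..t, ∫ φ in (0:ℝ)..Real.pi, ∫ θ in (0:ℝ)..(2 * Real.pi),
      Real.sin φ * rayDeriv c u (om φ θ) τ (c * t - c * τ) :=
    integral_rotate_of_continuous hD _ _ _ _ _ _
  have e3 : (∫ τ in (0:ℝ)..t, ∫ φ in (0:ℝ)..Real.pi, ∫ θ in (0:ℝ)..(2 * Real.pi),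
      Real.sin φ * rayDeriv c u (om φ θ) τ (c * t - c * τ)) =
      ∫ τ in (0:ℝ)..t, (c * t - c * τ) * sphInt (box c u τ) (c * t - c * τ) := by
    apply intervalIntegral.integral_congr_ae
    have hne : ∀ᵐ τ : ℝ, τ ≠ t := by
      simp [MeasureTheory.ae_iff, MeasureTheory.measure_singleton]
    filter_upwards [hne] with τ hτ _
    have hs : c * t - c * τ ≠ 0 := by
      rw [← mul_sub]
      exact mul_ne_zero hc (sub_ne_zero.2 (Ne.symm hτ))
    have := sphInt_add_const_mul (f := box c u τ) (g := rotA 0 1 (rotA 0 1 u) τ)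
      (h := rotA 0 2 (rotA 0 2 u) τ) (k := rotA 1 2 (rotA 1 2 u) τ) (c * t - c * τ)
      (c ^ 2 * (c * t - c * τ)⁻¹) (c * t - c * τ) ((hu.box c).continuous_right τ)
      (((hu.rotA 0 1).rotA 0 1).continuous_right τ) (((hu.rotA 0 2).rotA 0 2).continuous_right τ)
      (((hu.rotA 1 2).rotA 1 2).continuous_right τ)
    rw [sphInt_rotA (hu.rotA 0 1) _ _ (by decide), sphInt_rotA (hu.rotA 0 2) _ _ (by decide),
      sphInt_rotA (hu.rotA 1 2) _ _ (by decide)] at this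
    rw [show (c * t - c * τ) * sphInt (box c u τ) (c * t - c * τ) = (c * t - c * τ) *
      sphInt (box c u τ) (c * t - c * τ) + c ^ 2 * (c * t - c * τ)⁻¹ * (0 + 0 + 0) by ring, ← this]
    unfold sphInt
    congr 1
    funext φ
    congr 1
    funext θ
    rw [rayDeriv_eq hu c (sum_sq_om φ θ) _ _ hs]
  rw [← e3, ← e2, e1]
  ring

theorem norm_smul_ev_add_smul_om (r s φ θ : ℝ) :
    ‖r • ev 2 + s • om φ θ‖ = √(r ^ 2 + s ^ 2 + 2 * r * s * Real.cos φ) := by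
  rw [EuclideanSpace.norm_eq]
  congr 1
  simp [Fin.sum_univ_three]
  have h1 := Real.sin_sq_add_cos_sq φ
  have h2 := Real.sin_sq_add_cos_sq θ
  linear_combination s ^ 2 * h1 + s ^ 2 * (Real.sin φ) ^ 2 * h2

/-- Spherical means about a shifted centre of functions controlled by a radial weight. -/
theorem abs_sphInt_le {r s : ℝ} (hr : 0 < r) (hs : 0 < s) {g : E3 → ℝ} (hg : Continuous g)
    {k : ℝ → ℝ} (hk : Continuous k)
    (h : ∀ y, ‖y‖ = s → ‖r • ev 2 + y‖ * |g y| ≤ k ‖r • ev 2 + y‖) :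
    |sphInt g s| ≤ 2 * Real.pi / (r * s) * ∫ l in |r - s|..(r + s), k l := by
  have hpi := Real.pi_pos
  set ρ : ℝ → ℝ := fun φ => √(r ^ 2 + s ^ 2 + 2 * r * s * Real.cos φ) with hρ
  have hgc : Continuous (Function.uncurry fun φ θ => |Real.sin φ * g (s • om φ θ)|) :=
    ((Real.continuous_sin.comp continuous_fst).mul (hg.comp (continuous_om.const_smul s))).abs
  have hgc' : Continuous (Function.uncurry fun φ θ => Real.sin φ * g (s • om φ θ)) :=
    ((Real.continuous_sin.comp continuous_fst).mul (hg.comp (continuous_om.const_smul s)))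
  have hΦ : Continuous fun φ => ∫ θ in (0:ℝ)..(2 * Real.pi), |Real.sin φ * g (s • om φ θ)| :=
    intervalIntegral.continuous_parametric_intervalIntegral_of_continuous' hgc _ _
  have hΦ' : Continuous fun φ => ∫ θ in (0:ℝ)..(2 * Real.pi), Real.sin φ * g (s • om φ θ) :=
    intervalIntegral.continuous_parametric_intervalIntegral_of_continuous' hgc' _ _
  have step1 : |sphInt g s| ≤
      ∫ φ in (0:ℝ)..Real.pi, ∫ θ in (0:ℝ)..(2 * Real.pi), |Real.sin φ * g (s • om φ θ)| := by
    refine (intervalIntegral.abs_integral_le_integral_abs hpi.le).trans ?_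
    refine intervalIntegral.integral_mono_on hpi.le (hΦ'.abs.intervalIntegrable _ _)
      (hΦ.intervalIntegrable _ _) fun φ _ => ?_
    exact intervalIntegral.abs_integral_le_integral_abs (by positivity)
  have hρc : Continuous ρ := by fun_prop
  have hρd : ∀ φ ∈ Set.Ioo (0:ℝ) Real.pi, 0 < ρ φ ∧
      HasDerivAt ρ (-(r * s * Real.sin φ / ρ φ)) φ := by
    intro φ hφ
    have hcos : -1 < Real.cos φ := by
      rw [← Real.cos_pi]
      exact Real.cos_lt_cos_of_nonneg_of_le_pi hφ.1.le le_rfl hφ.2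
    have hpos : 0 < r ^ 2 + s ^ 2 + 2 * r * s * Real.cos φ := by
      nlinarith [sq_nonneg (r - s), mul_pos hr hs, mul_pos (mul_pos hr hs) (neg_lt_iff_pos_add.1 hcos)]
    have h1 : HasDerivAt (fun φ => r ^ 2 + s ^ 2 + 2 * r * s * Real.cos φ)
        (2 * r * s * (-Real.sin φ)) φ :=
      ((Real.hasDerivAt_cos φ).const_mul (2 * r * s)).const_add _
    refine ⟨Real.sqrt_pos.2 hpos, (h1.sqrt hpos.ne').congr_deriv ?_⟩
    have : √(r ^ 2 + s ^ 2 + 2 * r * s * Real.cos φ) ≠ 0 := (Real.sqrt_pos.2 hpos).ne'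
    simp only [hρ]
    field_simp
  have hK : ∀ l, HasDerivAt (fun l => ∫ x in (0:ℝ)..l, k x) (k l) l := fun l =>
    intervalIntegral.integral_hasDerivAt_right (hk.intervalIntegrable _ _)
      hk.stronglyMeasurable.stronglyMeasurableAtFilter hk.continuousAt
  have hKc : Continuous fun l => ∫ x in (0:ℝ)..l, k x :=
    continuous_iff_continuousAt.2 fun l => (hK l).continuousAt
  have step2 := intervalIntegral.integral_le_sub_of_hasDeriv_right_of_le
    (g := fun φ => -(2 * Real.pi / (r * s)) * ∫ x in (0:ℝ)..(ρ φ), k x)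
    (g' := fun φ => 2 * Real.pi * (Real.sin φ * (k (ρ φ) / ρ φ)))
    (φ := fun φ => ∫ θ in (0:ℝ)..(2 * Real.pi), |Real.sin φ * g (s • om φ θ)|)
    hpi.le (continuous_const.mul (hKc.comp hρc)).continuousOn
    (fun φ hφ => by
      obtain ⟨h0, h1⟩ := hρd φ hφ
      refine ((((hK (ρ φ)).comp φ h1).const_mul _).congr_deriv ?_).hasDerivWithinAt
      field_simp)
    (hΦ.integrableOn_Icc)
    (fun φ hφ => by
      obtain ⟨h0, h1⟩ := hρd φ hφ
      have hsin := Real.sin_pos_of_mem_Ioo hφ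
      have : ∀ θ ∈ Set.Icc (0:ℝ) (2 * Real.pi),
          |Real.sin φ * g (s • om φ θ)| ≤ Real.sin φ * (k (ρ φ) / ρ φ) := by
        intro θ _
        rw [abs_mul, abs_of_pos hsin]
        gcongr
        have := h (s • om φ θ) (by rw [norm_smul, norm_om, Real.norm_eq_abs, abs_of_pos hs, mul_one])
        rw [norm_smul_ev_add_smul_om] at this
        rw [le_div_iff₀ h0, mul_comm]
        exact this
      refine (intervalIntegral.integral_mono_on (by positivity)
        ((hgc.comp (Continuous.prodMk_right φ)).intervalIntegrable _ _)
        (continuous_const.intervalIntegrable _ _) this).trans ?_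
      rw [intervalIntegral.integral_const, smul_eq_mul, sub_zero])
  have hρ0 : ρ 0 = r + s := by
    simp only [hρ, Real.cos_zero]
    rw [show r ^ 2 + s ^ 2 + 2 * r * s * 1 = (r + s) ^ 2 by ring, Real.sqrt_sq (by positivity)]
  have hρ1 : ρ Real.pi = |r - s| := by
    simp only [hρ, Real.cos_pi]
    rw [show r ^ 2 + s ^ 2 + 2 * r * s * -1 = (r - s) ^ 2 by ring, Real.sqrt_sq_eq_abs]
  refine step1.trans (step2.trans (le_of_eq ?_))
  simp only [hρ0, hρ1]
  rw [← intervalIntegral.integral_interval_sub_left (hk.intervalIntegrable 0 (r + s))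
    (hk.intervalIntegrable 0 |r - s|)]
  ring

/-- There is a linear isometry carrying `‖x‖ • e₃` to `x`. -/
theorem exists_isometry_map_ev (x : E3) :
    ∃ R : E3 ≃ₗᵢ[ℝ] E3, R (‖x‖ • ev 2) = x := by
  refine ⟨(ℝ ∙ (‖x‖ • ev 2 - x))ᗮ.reflection, Submodule.reflection_sub ?_⟩
  simp [norm_smul]

theorem box_rigid {f : Fn} (hf : Smooth f) (c : ℝ) (x : E3) (R : E3 ≃ₗᵢ[ℝ] E3) :
    box c (rigid x R f) = rigid x R (box c f) := by
  unfold box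
  rw [lap_rigid hf]
  rfl

theorem continuous_sphInt {f : Fn} (hf : Continuous fun p : ℝ × E3 => f p.1 p.2) {b : ℝ → ℝ}
    (hb : Continuous b) : Continuous fun τ => sphInt (f τ) (b τ) := by
  have ho : Continuous fun q : (ℝ × ℝ) × ℝ => om q.1.2 q.2 :=
    Continuous.comp (g := fun p : ℝ × ℝ => om p.1 p.2) (f := fun q : (ℝ × ℝ) × ℝ => (q.1.2, q.2))
      continuous_om (by fun_prop)
  have hq2 : Continuous fun q : (ℝ × ℝ) × ℝ => (q.1.1, b q.1.1 • om q.1.2 q.2) := by fun_prop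
  have hq : Continuous fun q : (ℝ × ℝ) × ℝ =>
      Real.sin q.1.2 * f q.1.1 (b q.1.1 • om q.1.2 q.2) :=
    (by fun_prop : Continuous fun q : (ℝ × ℝ) × ℝ => Real.sin q.1.2).mul (hf.comp hq2)
  have h1 : Continuous fun p : ℝ × ℝ => ∫ θ in (0:ℝ)..(2 * Real.pi),
      Real.sin p.2 * f p.1 (b p.1 • om p.2 θ) :=
    intervalIntegral.continuous_parametric_intervalIntegral_of_continuous'
      (f := fun (p : ℝ × ℝ) θ => Real.sin p.2 * f p.1 (b p.1 • om p.2 θ)) hq _ _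
  exact intervalIntegral.continuous_parametric_intervalIntegral_of_continuous'
    (f := fun τ φ => ∫ θ in (0:ℝ)..(2 * Real.pi), Real.sin φ * f τ (b τ • om φ θ)) h1 _ _

theorem continuous_intervalIntegral_of_continuous {k : ℝ → ℝ → ℝ}
    (hk : Continuous (Function.uncurry k)) {a b : ℝ → ℝ} (ha : Continuous a) (hb : Continuous b) :
    Continuous fun τ => ∫ l in (a τ)..(b τ), k τ l := by
  have h1 : Continuous fun τ => ∫ l in (0:ℝ)..(b τ), k τ l :=
    intervalIntegral.continuous_parametric_intervalIntegral_of_continuous hk hb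
  have h2 : Continuous fun τ => ∫ l in (0:ℝ)..(a τ), k τ l :=
    intervalIntegral.continuous_parametric_intervalIntegral_of_continuous hk ha
  refine (h1.sub h2).congr fun τ => ?_
  have hkτ : Continuous (k τ) := hk.comp (Continuous.prodMk_right τ)
  exact intervalIntegral.integral_interval_sub_left (hkτ.intervalIntegrable _ _)
    (hkτ.intervalIntegrable _ _)

theorem mul_abs_sphInt_le {x : E3} (hx : x ≠ 0) (R : E3 ≃ₗᵢ[ℝ] E3) (hR : R (‖x‖ • ev 2) = x)
    {s : ℝ} (hs : 0 ≤ s) {g : E3 → ℝ} (hg : Continuous g) {k : ℝ → ℝ} (hk : Continuous k)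
    (h : ∀ y, ‖y - x‖ = s → ‖y‖ * |g y| ≤ k ‖y‖) :
    s * |sphInt (fun y => g (x + R y)) s| ≤
      2 * Real.pi / ‖x‖ * ∫ l in |‖x‖ - s|..(‖x‖ + s), k l := by
  rcases hs.eq_or_lt with rfl | hs
  · simp
  have hxp : 0 < ‖x‖ := norm_pos_iff.2 hx
  have hnorm : ∀ y : E3, ‖x + R y‖ = ‖‖x‖ • ev 2 + y‖ := by
    intro y
    calc ‖x + R y‖ = ‖R (‖x‖ • ev 2) + R y‖ := by rw [hR]
      _ = _ := by rw [← map_add, LinearIsometryEquiv.norm_map]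
  have := abs_sphInt_le hxp hs (g := fun y => g (x + R y))
    (hg.comp (continuous_const.add R.continuous)) hk (fun y hy => by
    rw [← hnorm]
    exact h _ (by simpa using hy))
  calc _ ≤ s * (2 * Real.pi / (‖x‖ * s) * ∫ l in |‖x‖ - s|..(‖x‖ + s), k l) := by gcongr
    _ = _ := by field_simp

/-- The spherical integral estimate for the wave equation with vanishing initial position. -/
theorem abs_le_of_weighted {u : Fn} (hu : Smooth u) {c t : ℝ} (hc : 0 < c) (ht : 0 < t) {x : E3}
    (hx : x ≠ 0) (h0 : ∀ y, u 0 y = 0) {k : ℝ → ℝ → ℝ} (hk : Continuous (Function.uncurry k))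
    {k0 : ℝ → ℝ} (hk0 : Continuous k0)
    (hd : ∀ y, ‖y - x‖ = c * t → ‖y‖ * |pt u 0 y| ≤ k0 ‖y‖)
    (hG : ∀ τ y, 0 ≤ τ → τ ≤ t → ‖y - x‖ = c * t - c * τ → ‖y‖ * |box c u τ y| ≤ k τ ‖y‖) :
    2 * c * ‖x‖ * |u t x| ≤ (∫ l in |‖x‖ - c * t|..(‖x‖ + c * t), k0 l) +
      ∫ τ in (0:ℝ)..t, ∫ l in |‖x‖ - (c * t - c * τ)|..(‖x‖ + (c * t - c * τ)), k τ l := by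
  obtain ⟨R, hR⟩ := exists_isometry_map_ev x
  have hpi := Real.pi_pos
  have hxp : 0 < ‖x‖ := norm_pos_iff.2 hx
  have hkir := kirchhoff (hu.rigid x R) c hc.ne' t (fun y => h0 _)
  have b0 := mul_abs_sphInt_le hx R hR (by positivity : 0 ≤ c * t)
    (hu.pt.continuous_right 0) hk0 hd
  have b1 : ∀ τ ∈ Set.Icc (0:ℝ) t,
      |(c * t - c * τ) * sphInt (box c (rigid x R u) τ) (c * t - c * τ)| ≤ 2 * Real.pi / ‖x‖ *
      ∫ l in |‖x‖ - (c * t - c * τ)|..(‖x‖ + (c * t - c * τ)), k τ l := by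
    intro τ hτ
    have hs : 0 ≤ c * t - c * τ := by nlinarith [hτ.2]
    rw [abs_mul, abs_of_nonneg hs, box_rigid hu]
    exact mul_abs_sphInt_le hx R hR hs ((hu.box c).continuous_right τ)
      (hk.comp (Continuous.prodMk_right τ)) (fun y hy => hG _ _ hτ.1 hτ.2 hy)
  have hsph : Continuous fun τ =>
      (c * t - c * τ) * sphInt (box c (rigid x R u) τ) (c * t - c * τ) :=
    Continuous.mul (by fun_prop)
      (continuous_sphInt ((hu.rigid x R).box c).continuous (by fun_prop))
  have hrhs : Continuous fun τ =>
      ∫ l in |‖x‖ - (c * t - c * τ)|..(‖x‖ + (c * t - c * τ)), k τ l :=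
    continuous_intervalIntegral_of_continuous hk (by fun_prop) (by fun_prop)
  have b2 : |∫ τ in (0:ℝ)..t,
        (c * t - c * τ) * sphInt (box c (rigid x R u) τ) (c * t - c * τ)| ≤
      2 * Real.pi / ‖x‖ *
      ∫ τ in (0:ℝ)..t, ∫ l in |‖x‖ - (c * t - c * τ)|..(‖x‖ + (c * t - c * τ)), k τ l := by
    rw [← intervalIntegral.integral_const_mul]
    refine (intervalIntegral.abs_integral_le_integral_abs ht.le).trans ?_
    exact intervalIntegral.integral_mono_on ht.le (hsph.abs.intervalIntegrable _ _)
      ((continuous_const.mul hrhs).intervalIntegrable _ _) b1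
  have hv0 : rigid x R u t 0 = u t x := by simp [rigid]
  have habs : |4 * Real.pi * c * u t x| = 4 * Real.pi * c * |u t x| := by
    rw [abs_mul, abs_of_pos (by positivity)]
  rw [hv0] at hkir
  have hfin : 4 * Real.pi * c * |u t x| ≤ 2 * Real.pi / ‖x‖ *
      ((∫ l in |‖x‖ - c * t|..(‖x‖ + c * t), k0 l) +
      ∫ τ in (0:ℝ)..t, ∫ l in |‖x‖ - (c * t - c * τ)|..(‖x‖ + (c * t - c * τ)), k τ l) := by
    rw [← habs, hkir, mul_add]
    refine (abs_add_le _ _).trans (add_le_add ?_ b2)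
    rw [abs_mul, abs_of_pos (by positivity : 0 < c * t)]
    exact b0
  rw [div_mul_eq_mul_div, le_div_iff₀ hxp] at hfin
  have h2pi : (0:ℝ) < 2 * Real.pi := by positivity
  refine le_of_mul_le_mul_left ?_ h2pi
  linarith

theorem one_le_jb (a : ℝ) : 1 ≤ jb a := by
  rw [jb, Real.one_le_sqrt]
  nlinarith [sq_nonneg a]

theorem jb_pos (a : ℝ) : 0 < jb a := one_pos.trans_le (one_le_jb a)

theorem continuous_jb : Continuous jb := by
  unfold jb
  fun_prop

theorem continuous_jb_rpow {X : Type*} [TopologicalSpace X] {f : X → ℝ} (hf : Continuous f)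
    (p : ℝ) : Continuous fun x => jb (f x) ^ p :=
  (continuous_jb.comp hf).rpow_const fun _ => Or.inl (jb_pos _).ne'

theorem jb_le_mul {K a b : ℝ} (hK : 1 ≤ K) (h : |b| ≤ K * |a|) : jb b ≤ K * jb a := by
  have hK0 : 0 ≤ K := zero_le_one.trans hK
  rw [jb, jb, Real.sqrt_le_left (by positivity), mul_pow, Real.sq_sqrt (by positivity),
    ← sq_abs b, ← sq_abs a]
  nlinarith [abs_nonneg a, abs_nonneg b, mul_nonneg hK0 (abs_nonneg a)]

theorem jb_le_jb {a b : ℝ} (h : |b| ≤ |a|) : jb b ≤ jb a := by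
  simpa using jb_le_mul le_rfl (by simpa using h)

theorem jb_le_one_add {a : ℝ} (ha : 0 ≤ a) : jb a ≤ 1 + a := by
  rw [jb, Real.sqrt_le_left (by positivity)]
  nlinarith

theorem one_add_le_two_mul_jb (a : ℝ) : 1 + a ≤ 2 * jb a := by
  have h1 := one_le_jb a
  have h2 : a ≤ jb a := Real.le_sqrt_of_sq_le (by linarith)
  linarith

theorem jb_rpow_neg_le (a : ℝ) {p : ℝ} (hp : 0 ≤ p) (ha : 0 ≤ a) :
    jb a ^ (-p) ≤ 2 ^ p * (1 + a) ^ (-p) := by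
  rw [Real.rpow_neg (jb_pos a).le, Real.rpow_neg (by positivity), ← div_eq_mul_inv,
    inv_eq_one_div, div_le_div_iff₀ (Real.rpow_pos_of_pos (jb_pos a) p) (by positivity), one_mul,
    ← Real.mul_rpow zero_le_two (jb_pos a).le]
  exact Real.rpow_le_rpow (by positivity) (one_add_le_two_mul_jb a) hp

theorem integral_one_add_rpow {a b q : ℝ} (ha : 0 ≤ a) (hab : a ≤ b) (hq : q ≠ 0) :
    ∫ x in a..b, (1 + x) ^ (q - 1) = ((1 + b) ^ q - (1 + a) ^ q) / q := by
  rw [intervalIntegral.integral_comp_add_left (fun x => x ^ (q - 1)) 1, integral_rpow]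
  · simp
  · refine Or.inr ⟨by intro h; apply hq; linarith, ?_⟩
    rw [Set.uIcc_of_le (by linarith)]
    intro h
    linarith [h.1]

theorem continuousOn_one_add_rpow {a b : ℝ} (ha : 0 ≤ a) (p : ℝ) :
    ContinuousOn (fun x : ℝ => (1 + x) ^ p) (Set.Icc a b) :=
  ContinuousOn.rpow_const (by fun_prop) fun x hx => Or.inl (by linarith [hx.1])

theorem integral_jb_rpow_le {a b p : ℝ} (ha : 0 ≤ a) (hab : a ≤ b) (hp : 0 ≤ p) :
    ∫ x in a..b, jb x ^ (-p) ≤ 2 ^ p * ∫ x in a..b, (1 + x) ^ (-p) := by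
  rw [← intervalIntegral.integral_const_mul]
  refine intervalIntegral.integral_mono_on hab
    ((continuous_jb_rpow continuous_id _).intervalIntegrable _ _) ?_
    fun x hx => jb_rpow_neg_le x hp (ha.trans hx.1)
  exact ((continuousOn_one_add_rpow ha _).intervalIntegrable_of_Icc hab).const_mul _

/-- Decay of the tail integral of `⟨α⟩^(-κ)` for `κ > 1`. -/
theorem integral_jb_rpow_tail {κ : ℝ} (hκ : 1 < κ) {a b : ℝ} (ha : 0 ≤ a) (hab : a ≤ b) :
    ∫ x in a..b, jb x ^ (-κ) ≤ 2 ^ κ / (κ - 1) * jb a ^ (1 - κ) := by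
  refine (integral_jb_rpow_le ha hab (by linarith)).trans ?_
  have h := integral_one_add_rpow ha hab (by linarith : 1 - κ ≠ 0)
  rw [show 1 - κ - 1 = -κ by ring] at h
  rw [h, div_mul_eq_mul_div, mul_div_assoc]
  refine mul_le_mul_of_nonneg_left ?_ (by positivity)
  have h1 : (1 + a) ^ (1 - κ) ≤ jb a ^ (1 - κ) :=
    Real.rpow_le_rpow_of_nonpos (jb_pos a) (jb_le_one_add ha) (by linarith)
  have h2 : 0 ≤ (1 + b) ^ (1 - κ) := Real.rpow_nonneg (by linarith) _
  rw [← neg_div_neg_eq]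
  rw [div_le_div_iff₀ (by linarith) (by linarith)]
  nlinarith

/-- Growth of the integral of `⟨α⟩^(1-κ)` over a symmetric interval, for `1 < κ < 2`. -/
theorem integral_jb_rpow_symm {κ : ℝ} (hκ1 : 1 < κ) (hκ2 : κ < 2) {m : ℝ} (hm : 0 ≤ m) :
    ∫ x in (-m)..m, jb x ^ (1 - κ) ≤ 8 / (2 - κ) * jb m ^ (2 - κ) := by
  have hc : Continuous fun x => jb x ^ (1 - κ) := continuous_jb_rpow continuous_id _
  have hsymm : ∫ x in (-m)..0, jb x ^ (1 - κ) = ∫ x in (0:ℝ)..m, jb x ^ (1 - κ) := by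
    have := intervalIntegral.integral_comp_neg (a := 0) (b := m) fun x => jb x ^ (1 - κ)
    rw [neg_zero] at this
    rw [← this]
    simp [jb]
  rw [← intervalIntegral.integral_add_adjacent_intervals (hc.intervalIntegrable (-m) 0)
    (hc.intervalIntegrable 0 m), hsymm, ← two_mul]
  have h1 := integral_jb_rpow_le (p := κ - 1) le_rfl hm (by linarith)
  have h2 := integral_one_add_rpow le_rfl hm (by linarith : 2 - κ ≠ 0)
  rw [show 2 - κ - 1 = -(κ - 1) by ring] at h2
  rw [h2, show -(κ - 1) = 1 - κ by ring] at h1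
  have h3 : (1 + m) ^ (2 - κ) ≤ 2 ^ (2 - κ) * jb m ^ (2 - κ) := by
    rw [← Real.mul_rpow zero_le_two (jb_pos m).le]
    exact Real.rpow_le_rpow (by positivity) (one_add_le_two_mul_jb m) (by linarith)
  have h4 : (2:ℝ) ^ (κ - 1) * 2 ^ (2 - κ) = 2 := by
    rw [← Real.rpow_add two_pos]
    norm_num
  have h5 : (0:ℝ) < 2 ^ (κ - 1) := by positivity
  calc 2 * ∫ x in (0:ℝ)..m, jb x ^ (1 - κ)
      ≤ 2 * (2 ^ (κ - 1) * ((2 ^ (2 - κ) * jb m ^ (2 - κ)) / (2 - κ))) := by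
        refine mul_le_mul_of_nonneg_left (h1.trans (mul_le_mul_of_nonneg_left ?_ h5.le)) zero_le_two
        refine div_le_div_of_nonneg_right ?_ (by linarith)
        have : (0:ℝ) ≤ (1 + 0) ^ (2 - κ) := by positivity
        linarith
    _ = 4 / (2 - κ) * jb m ^ (2 - κ) := by
        linear_combination (2 * jb m ^ (2 - κ) / (2 - κ)) * h4
    _ ≤ _ := by
        refine mul_le_mul_of_nonneg_right ?_ (Real.rpow_nonneg (jb_pos m).le _)
        exact div_le_div_of_nonneg_right (by norm_num) (by linarith)

theorem integrable_jb_rpow {μ : ℝ} (hμ : 0 < μ) :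
    MeasureTheory.Integrable fun x => jb x ^ (-(1 + μ)) := by
  have := integrable_rpow_neg_one_add_norm_sq (E := ℝ) (μ := MeasureTheory.volume) (r := 1 + μ)
    (by simpa using hμ)
  refine this.congr (Filter.Eventually.of_forall fun x => ?_)
  simp only [jb, Real.norm_eq_abs, sq_abs]
  rw [Real.sqrt_eq_rpow, ← Real.rpow_mul (by positivity)]
  congr 1
  ring

/-- The weights `⟨kτ - m⟩^(-1-μ)` are integrable in `τ`, uniformly in `m`. -/
theorem integral_jb_shift_le {μ : ℝ} (hμ : 0 < μ) {k : ℝ} (hk : 0 < k) {a b : ℝ} (hab : a ≤ b)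
    (m : ℝ) :
    ∫ τ in a..b, jb (k * τ - m) ^ (-(1 + μ)) ≤ k⁻¹ * ∫ x, jb x ^ (-(1 + μ)) := by
  rw [intervalIntegral.integral_comp_mul_sub (fun x => jb x ^ (-(1 + μ))) hk.ne', smul_eq_mul]
  refine mul_le_mul_of_nonneg_left ?_ (by positivity)
  rw [intervalIntegral.integral_of_le (by nlinarith)]
  exact MeasureTheory.setIntegral_le_integral (integrable_jb_rpow hμ)
    (Filter.Eventually.of_forall fun x => Real.rpow_nonneg (jb_pos x).le _)

/-- Sum of the inverse weights along characteristics. -/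
def swt {n : ℕ} (k : Fin n → ℝ) (μ τ α : ℝ) : ℝ := ∑ j, jb (k j * τ - α) ^ (-(1 + μ))

theorem swt_nonneg {n : ℕ} (k : Fin n → ℝ) (μ τ α : ℝ) : 0 ≤ swt k μ τ α :=
  Finset.sum_nonneg fun _ _ => Real.rpow_nonneg (jb_pos _).le _

theorem continuous_swt {n : ℕ} (k : Fin n → ℝ) (μ : ℝ) :
    Continuous (Function.uncurry (swt k μ)) := by
  change Continuous fun p : ℝ × ℝ => ∑ j, jb (k j * p.1 - p.2) ^ (-(1 + μ))
  refine continuous_finsetSum _ fun j _ => ?_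
  exact continuous_jb_rpow (f := fun p : ℝ × ℝ => k j * p.1 - p.2) (by fun_prop) _

/-- The uniform bound for the integrals of `swt`. -/
def swtBound {n : ℕ} (k : Fin n → ℝ) (μ : ℝ) : ℝ :=
  ∑ j, (k j)⁻¹ * ∫ x, jb x ^ (-(1 + μ))

theorem swtBound_nonneg {n : ℕ} {k : Fin n → ℝ} (hk : ∀ j, 0 < k j) (μ : ℝ) :
    0 ≤ swtBound k μ :=
  Finset.sum_nonneg fun j _ => mul_nonneg (inv_nonneg.2 (hk j).le)
    (MeasureTheory.integral_nonneg fun x => Real.rpow_nonneg (jb_pos x).le _)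

theorem integral_swt_le {n : ℕ} {k : Fin n → ℝ} (hk : ∀ j, 0 < k j) {μ : ℝ} (hμ : 0 < μ)
    {a b : ℝ} (hab : a ≤ b) (m : ℝ) : ∫ τ in a..b, swt k μ τ m ≤ swtBound k μ := by
  unfold swt swtBound
  rw [intervalIntegral.integral_finsetSum fun j _ =>
    (continuous_jb_rpow (by fun_prop) _).intervalIntegrable _ _]
  exact Finset.sum_le_sum fun j _ => integral_jb_shift_le hμ (hk j) hab m

/-- The weight bounding the source term in terms of `τ` and `|y|`. -/
def srcWt {n : ℕ} (c : ℝ) (k : Fin n → ℝ) (κ μ τ l : ℝ) : ℝ :=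
  jb (c * τ + l) ^ (-κ) * swt k μ τ (c * τ + l)

theorem continuous_srcWt {n : ℕ} (c : ℝ) (k : Fin n → ℝ) (κ μ : ℝ) :
    Continuous (Function.uncurry (srcWt c k κ μ)) :=
  (continuous_jb_rpow (f := fun p : ℝ × ℝ => c * p.1 + p.2) (by fun_prop) _).mul
    ((continuous_swt k μ).comp
      (by fun_prop : Continuous fun p : ℝ × ℝ => (p.1, c * p.1 + p.2)))

/-- The integral of the source weight over the radial projection of the backward cone. -/
theorem integral_srcWt_le {n : ℕ} {k : Fin n → ℝ} (hk : ∀ j, 0 < k j) {c κ μ : ℝ} (hc : 0 < c)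
    (hκ : 1 < κ) (hμ : 0 < μ) {t r : ℝ} (ht : 0 ≤ t) (hr : 0 ≤ r) :
    ∫ τ in (0:ℝ)..t, ∫ l in |r - (c * t - c * τ)|..(r + (c * t - c * τ)), srcWt c k κ μ τ l ≤
      2 ^ κ / (κ - 1) * swtBound k μ * jb (c * t - r) ^ (1 - κ) := by
  have hF : Continuous (Function.uncurry fun τ α => jb α ^ (-κ) * swt k μ τ α) :=
    (continuous_jb_rpow continuous_snd _).mul (continuous_swt k μ)
  have hab : |c * t - r| ≤ r + c * t := by
    have : 0 ≤ c * t := by positivity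
    rw [abs_le]
    constructor <;> linarith
  have hL : Continuous fun τ =>
      ∫ l in |r - (c * t - c * τ)|..(r + (c * t - c * τ)), srcWt c k κ μ τ l :=
    continuous_intervalIntegral_of_continuous (continuous_srcWt c k κ μ) (by fun_prop)
      (by fun_prop)
  have hR : Continuous fun τ => ∫ α in |c * t - r|..(r + c * t), jb α ^ (-κ) * swt k μ τ α :=
    continuous_intervalIntegral_of_continuous hF continuous_const continuous_const
  have hR' : Continuous fun α => ∫ τ in (0:ℝ)..t, jb α ^ (-κ) * swt k μ τ α :=
    continuous_intervalIntegral_of_continuous (k := fun α τ => jb α ^ (-κ) * swt k μ τ α)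
      (hF.comp continuous_swap) continuous_const continuous_const
  have hle : ∀ τ ∈ Set.Icc 0 t,
      ∫ l in |r - (c * t - c * τ)|..(r + (c * t - c * τ)), srcWt c k κ μ τ l ≤
      ∫ α in |c * t - r|..(r + c * t), jb α ^ (-κ) * swt k μ τ α := by
    intro τ hτ
    have hcτ : 0 ≤ c * τ := mul_nonneg hc.le hτ.1
    have hct : c * τ ≤ c * t := mul_le_mul_of_nonneg_left hτ.2 hc.le
    unfold srcWt
    rw [intervalIntegral.integral_comp_add_left (fun α => jb α ^ (-κ) * swt k μ τ α),
      show c * τ + (r + (c * t - c * τ)) = r + c * t by ring]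
    refine intervalIntegral.integral_mono_interval ?_ ?_ le_rfl
      (Filter.Eventually.of_forall fun α => mul_nonneg (Real.rpow_nonneg (jb_pos α).le _)
        (swt_nonneg _ _ _ _))
      ((hF.comp (Continuous.prodMk_right τ)).intervalIntegrable _ _)
    · rcases abs_cases (c * t - r) with h | h <;>
        rcases abs_cases (r - (c * t - c * τ)) with h' | h' <;> linarith
    · rcases abs_cases (r - (c * t - c * τ)) with h' | h' <;> linarith
  calc _ ≤ ∫ τ in (0:ℝ)..t, ∫ α in |c * t - r|..(r + c * t), jb α ^ (-κ) * swt k μ τ α :=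
        intervalIntegral.integral_mono_on ht (hL.intervalIntegrable _ _)
          (hR.intervalIntegrable _ _) hle
    _ = ∫ α in |c * t - r|..(r + c * t), ∫ τ in (0:ℝ)..t, jb α ^ (-κ) * swt k μ τ α :=
        integral_swap_of_continuous hF _ _ _ _
    _ ≤ ∫ α in |c * t - r|..(r + c * t), swtBound k μ * jb α ^ (-κ) := by
        refine intervalIntegral.integral_mono_on hab (hR'.intervalIntegrable _ _)
          (((continuous_jb_rpow continuous_id _).const_mul _).intervalIntegrable _ _) fun α _ => ?_
        rw [intervalIntegral.integral_const_mul, mul_comm]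
        exact mul_le_mul_of_nonneg_right (integral_swt_le hk hμ ht α)
          (Real.rpow_nonneg (jb_pos α).le _)
    _ ≤ swtBound k μ * (2 ^ κ / (κ - 1) * jb |c * t - r| ^ (1 - κ)) := by
        rw [intervalIntegral.integral_const_mul]
        exact mul_le_mul_of_nonneg_left (integral_jb_rpow_tail hκ (abs_nonneg _) hab)
          (swtBound_nonneg hk μ)
    _ = _ := by
        simp only [jb, sq_abs]
        ring

/-- A uniform bound for the source on the backward cone gives a bound for the solution. -/
theorem abs_le_of_bounded {u : Fn} (hu : Smooth u) {c t M₀ M : ℝ} (hc : 0 < c) (ht : 0 < t)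
    (hM₀ : 0 ≤ M₀) (hM : 0 ≤ M) {x : E3} (hx : x ≠ 0) (h0 : ∀ y, u 0 y = 0)
    (hd : ∀ y, ‖y - x‖ ≤ c * t → ‖y‖ * |pt u 0 y| ≤ M₀)
    (hG : ∀ τ y, 0 ≤ τ → τ ≤ t → ‖y - x‖ ≤ c * (t - τ) → ‖y‖ * |box c u τ y| ≤ M) :
    c * |u t x| ≤ M₀ + M * t := by
  have hxp : 0 < ‖x‖ := norm_pos_iff.2 hx
  have h := abs_le_of_weighted hu hc ht hx h0 (k := fun _ _ => M) (k0 := fun _ => M₀)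
    continuous_const continuous_const (fun y hy => hd y hy.le)
    (fun τ y h1 h2 h3 => hG τ y h1 h2 (by rw [h3, mul_sub]))
  simp only [intervalIntegral.integral_const, smul_eq_mul] at h
  have hlen : ∀ s : ℝ, ‖x‖ + s - |‖x‖ - s| ≤ 2 * ‖x‖ := fun s => by
    linarith [neg_le_abs (‖x‖ - s)]
  have hsrc : ∫ τ in (0:ℝ)..t,
      (‖x‖ + (c * t - c * τ) - |‖x‖ - (c * t - c * τ)|) * M ≤ t * (2 * ‖x‖ * M) := by
    calc _ ≤ ∫ _ in (0:ℝ)..t, 2 * ‖x‖ * M :=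
          intervalIntegral.integral_mono_on ht.le
            ((by fun_prop : Continuous fun τ : ℝ =>
              (‖x‖ + (c * t - c * τ) - |‖x‖ - (c * t - c * τ)|) * M).intervalIntegrable _ _)
            (continuous_const.intervalIntegrable _ _)
            fun τ _ => mul_le_mul_of_nonneg_right (hlen _) hM
      _ = _ := by rw [intervalIntegral.integral_const, smul_eq_mul, sub_zero]
  have h2 := mul_le_mul_of_nonneg_right (hlen (c * t)) hM₀
  refine le_of_mul_le_mul_left ?_ (by positivity : 0 < 2 * ‖x‖)
  linarith

/-- The source `F` is dominated by the weight `srcWt` on the backward cone of `(t, x)`. -/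
def SrcBound {n : ℕ} (c : ℝ) (k : Fin n → ℝ) (κ μ M t : ℝ) (x : E3) (F : Fn) : Prop :=
  ∀ τ y, 0 ≤ τ → τ ≤ t → ‖y - x‖ ≤ c * (t - τ) → ‖y‖ * |F τ y| ≤ M * srcWt c k κ μ τ ‖y‖

theorem SrcBound.mono {n : ℕ} {c : ℝ} {k : Fin n → ℝ} {κ μ M t : ℝ} {x : E3} {F : Fn}
    (h : SrcBound c k κ μ M t x F) {t' : ℝ} {x' : E3} (ht : t' ≤ t)
    (hx : ‖x' - x‖ ≤ c * (t - t')) : SrcBound c k κ μ M t' x' F := by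
  intro τ y h0 h1 h2
  refine h τ y h0 (h1.trans ht) ?_
  calc ‖y - x‖ ≤ ‖y - x'‖ + ‖x' - x‖ := norm_sub_le_norm_sub_add_norm_sub _ _ _
    _ ≤ c * (t - τ) := by linarith

/-- The constant in the decay estimate for solutions. -/
def decayConst {n : ℕ} (c : ℝ) (k : Fin n → ℝ) (κ μ : ℝ) : ℝ :=
  2 ^ κ / (κ - 1) * swtBound k μ / (2 * c)

theorem decayConst_nonneg {n : ℕ} {k : Fin n → ℝ} (hk : ∀ j, 0 < k j) {c κ : ℝ} (hc : 0 < c)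
    (hκ : 1 < κ) (μ : ℝ) : 0 ≤ decayConst c k κ μ :=
  div_nonneg (mul_nonneg (div_nonneg (by positivity) (by linarith)) (swtBound_nonneg hk μ))
    (by positivity)

/-- Decay of solutions with vanishing data and weighted source. -/
theorem norm_mul_abs_le {n : ℕ} {k : Fin n → ℝ} (hk : ∀ j, 0 < k j) {c κ μ : ℝ} (hc : 0 < c)
    (hκ : 1 < κ) (hμ : 0 < μ) {u : Fn} (hu : Smooth u) (h0 : ∀ y, u 0 y = 0)
    (h1 : ∀ y, pt u 0 y = 0) {t M : ℝ} (ht : 0 ≤ t) (hM : 0 ≤ M) {x : E3}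
    (hG : SrcBound c k κ μ M t x (box c u)) :
    ‖x‖ * |u t x| ≤ M * (decayConst c k κ μ * jb (c * t - ‖x‖) ^ (1 - κ)) := by
  have hK := decayConst_nonneg hk hc hκ μ
  have hrhs : 0 ≤ M * (decayConst c k κ μ * jb (c * t - ‖x‖) ^ (1 - κ)) :=
    mul_nonneg hM (mul_nonneg hK (Real.rpow_nonneg (jb_pos _).le _))
  rcases ht.eq_or_lt with rfl | ht
  · simpa [h0] using hrhs
  rcases eq_or_ne x 0 with rfl | hx
  · simpa using hrhs
  have h := abs_le_of_weighted hu hc ht hx h0 (k := fun τ l => M * srcWt c k κ μ τ l)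
    (k0 := fun _ => 0) (continuous_const.mul (continuous_srcWt c k κ μ)) continuous_const
    (fun y _ => by simp [h1]) (fun τ y h1 h2 h3 => hG τ y h1 h2 (by rw [h3, mul_sub]))
  simp only [intervalIntegral.integral_zero, zero_add, intervalIntegral.integral_const_mul] at h
  have h' := mul_le_mul_of_nonneg_left
    (integral_srcWt_le hk hc hκ hμ ht.le (norm_nonneg x)) hM
  have h2c : 0 < 2 * c := by positivity
  refine le_of_mul_le_mul_left ?_ h2c
  calc 2 * c * (‖x‖ * |u t x|) = 2 * c * ‖x‖ * |u t x| := by ring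
    _ ≤ _ := h.trans h'
    _ = _ := by
      unfold decayConst
      field_simp

/-- The constant in the estimate along outgoing characteristics. -/
def rayConst {n : ℕ} (c : ℝ) (k : Fin n → ℝ) (κ μ L : ℝ) : ℝ :=
  swtBound k μ + 12 * c * decayConst c k κ μ * L ^ 2 / (2 - κ)

theorem abs_rayVal_le {n : ℕ} {k : Fin n → ℝ} (hk : ∀ j, 0 < k j) {c κ μ : ℝ} (hc : 0 < c)
    (hκ1 : 1 < κ) (hκ2 : κ < 2) (hμ : 0 < μ) {u : Fn} (hu : Smooth u) (h0 : ∀ y, u 0 y = 0)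
    (h1 : ∀ y, pt u 0 y = 0) {t r M L : ℝ} (ht : 0 < t) (hr : 0 < r) (hM : 0 ≤ M)
    (hL : jb (r + c * t) ≤ L * r) {ω : E3} (hω : ‖ω‖ = 1)
    (hG : SrcBound c k κ μ M t (r • ω) (box c u))
    (hΩ : ∀ i j : Fin 3, i < j →
      SrcBound c k κ μ M t (r • ω) (box c (rotA i j (rotA i j u)))) :
    |rayVal c u ω t r| ≤ M * rayConst c k κ μ L * jb (r + c * t) ^ (-κ) := by
  have hK := decayConst_nonneg hk hc hκ1 μ
  set K := decayConst c k κ μ with hKdef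
  set m := r + c * t with hm
  have hct : 0 < c * t := by positivity
  have hmpos : 0 < m := by positivity
  have hX := jb_pos m
  have hω2 : ∑ j, ω j ^ 2 = 1 := by
    have := EuclideanSpace.real_norm_sq_eq ω
    rw [hω] at this
    linarith
  have hray := integral_rayDeriv hu c m ω t h0
  rw [h1, mul_zero, sub_zero, show m - c * t = r by rw [hm]; ring] at hray
  have hpt : ∀ τ ∈ Set.Icc 0 t, |rayDeriv c u ω τ (m - c * τ)| ≤
      M * jb m ^ (-κ) * swt k μ τ m +
        3 * c ^ 2 * M * K / r ^ 2 * jb (2 * c * τ - m) ^ (1 - κ) := by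
    intro τ hτ
    have hcτ : c * τ ≤ c * t := mul_le_mul_of_nonneg_left hτ.2 hc.le
    have hrs : r ≤ m - c * τ := by rw [hm]; linarith
    have hs : 0 < m - c * τ := hr.trans_le hrs
    have hnorm : ‖(m - c * τ) • ω‖ = m - c * τ := by
      rw [norm_smul, hω, mul_one, Real.norm_eq_abs, abs_of_pos hs]
    have hdist : ‖(m - c * τ) • ω - r • ω‖ ≤ c * (t - τ) := by
      rw [← sub_smul, norm_smul, hω, mul_one, Real.norm_eq_abs, abs_of_nonneg (by linarith), hm]
      linarith
    have hrot : ∀ i j : Fin 3, i < j →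
        |rotA i j (rotA i j u) τ ((m - c * τ) • ω)| ≤
          (m - c * τ)⁻¹ * (M * (K * jb (2 * c * τ - m) ^ (1 - κ))) := by
      intro i j hij
      have hp : ∀ f : Fn, Smooth f → (∀ y, f 0 y = 0) → ∀ y, rotA i j f 0 y = 0 := by
        intro f hf hf0 y
        have hp : ∀ j x, PaperKatayama.pd j f 0 x = 0 := fun j x =>
          pd_of_hasDerivAt hf (by simp only [hf0]; exact hasDerivAt_const _ _)
        simp [rotA, hp]
      have h := norm_mul_abs_le hk hc hκ1 hμ ((hu.rotA i j).rotA i j)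
        (hp _ (hu.rotA i j) (hp _ hu h0))
        (by rw [pt_rotA (hu.rotA i j), pt_rotA hu]
            exact hp _ (hu.pt.rotA i j) (hp _ hu.pt h1)) hτ.1 hM
        ((hΩ i j hij).mono hτ.2 hdist)
      rw [hnorm, ← hKdef, show c * τ - (m - c * τ) = 2 * c * τ - m by ring] at h
      rw [inv_mul_eq_div, le_div_iff₀ hs, mul_comm]
      exact h
    have hsrc := hG τ _ hτ.1 hτ.2 hdist
    rw [hnorm, srcWt, show c * τ + (m - c * τ) = m by ring] at hsrc
    rw [rayDeriv_eq hu c hω2 τ _ hs.ne']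
    have e1 := hrot 0 1 (by decide)
    have e2 := hrot 0 2 (by decide)
    have e3 := hrot 1 2 (by decide)
    have hJ : 0 ≤ jb (2 * c * τ - m) ^ (1 - κ) := Real.rpow_nonneg (jb_pos _).le _
    refine (abs_add_le _ _).trans (add_le_add ?_ ?_)
    · rw [abs_mul, abs_of_pos hs, mul_assoc M]
      exact hsrc
    · rw [abs_mul, abs_of_nonneg (by positivity : 0 ≤ c ^ 2 * (m - c * τ)⁻¹)]
      have e4 := (abs_add_three _ _ _).trans (add_le_add (add_le_add e1 e2) e3)
      have e5 : (m - c * τ)⁻¹ ≤ r⁻¹ := inv_anti₀ hr hrs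
      have hMK : 0 ≤ M * (K * jb (2 * c * τ - m) ^ (1 - κ)) := by positivity
      calc _ ≤ c ^ 2 * (m - c * τ)⁻¹ *
            (3 * ((m - c * τ)⁻¹ * (M * (K * jb (2 * c * τ - m) ^ (1 - κ))))) := by
            gcongr
            linarith
        _ ≤ c ^ 2 * r⁻¹ * (3 * (r⁻¹ * (M * (K * jb (2 * c * τ - m) ^ (1 - κ))))) := by
            gcongr
        _ = _ := by
            field_simp
  have hcs : Continuous fun τ => swt k μ τ m :=
    (continuous_swt k μ).comp (Continuous.prodMk_left m)
  have hcj : Continuous fun τ => jb (2 * c * τ - m) ^ (1 - κ) :=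
    continuous_jb_rpow (by fun_prop) _
  have hcr : Continuous fun τ => rayDeriv c u ω τ (m - c * τ) :=
    (continuous_rayDeriv hu c m).comp (Continuous.prodMk_left ω)
  have hI := integral_swt_le hk hμ ht.le m
  have hJ : ∫ τ in (0:ℝ)..t, jb (2 * c * τ - m) ^ (1 - κ) ≤
      (2 * c)⁻¹ * (8 / (2 - κ) * jb m ^ (2 - κ)) := by
    rw [intervalIntegral.integral_comp_mul_sub (fun x => jb x ^ (1 - κ)) (by positivity),
      smul_eq_mul]
    refine mul_le_mul_of_nonneg_left ?_ (by positivity)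
    refine le_trans ?_ (integral_jb_rpow_symm hκ1 hκ2 hmpos.le)
    have hmt : 2 * c * t - m ≤ m := by rw [hm]; linarith
    refine intervalIntegral.integral_mono_interval (by linarith) (by linarith) hmt
      (Filter.Eventually.of_forall fun x => Real.rpow_nonneg (jb_pos x).le _)
      ((continuous_jb_rpow continuous_id _).intervalIntegrable _ _)
  have hXr : (r ^ 2)⁻¹ ≤ L ^ 2 * (jb m ^ 2)⁻¹ := by
    rw [← div_eq_mul_inv, inv_eq_one_div, div_le_div_iff₀ (by positivity) (by positivity), one_mul,
      ← mul_pow]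
    exact pow_le_pow_left₀ hX.le hL 2
  have hXp : (jb m ^ 2)⁻¹ * jb m ^ (2 - κ) = jb m ^ (-κ) := by
    rw [← Real.rpow_natCast (jb m) 2, ← Real.rpow_neg hX.le, ← Real.rpow_add hX]
    congr 1
    push_cast
    ring
  have hXκ : 0 ≤ jb m ^ (-κ) := Real.rpow_nonneg hX.le _
  have hXκ' : 0 ≤ jb m ^ (2 - κ) := Real.rpow_nonneg hX.le _
  have h2κ : 0 < 2 - κ := by linarith
  rw [← hray]
  calc |∫ τ in (0:ℝ)..t, rayDeriv c u ω τ (m - c * τ)|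
      ≤ ∫ τ in (0:ℝ)..t, |rayDeriv c u ω τ (m - c * τ)| :=
        intervalIntegral.abs_integral_le_integral_abs ht.le
    _ ≤ ∫ τ in (0:ℝ)..t, (M * jb m ^ (-κ) * swt k μ τ m +
        3 * c ^ 2 * M * K / r ^ 2 * jb (2 * c * τ - m) ^ (1 - κ)) :=
        intervalIntegral.integral_mono_on ht.le (hcr.abs.intervalIntegrable _ _)
          (((hcs.const_mul _).add (hcj.const_mul _)).intervalIntegrable _ _) hpt
    _ = M * jb m ^ (-κ) * (∫ τ in (0:ℝ)..t, swt k μ τ m) +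
        3 * c ^ 2 * M * K * (r ^ 2)⁻¹ * ∫ τ in (0:ℝ)..t, jb (2 * c * τ - m) ^ (1 - κ) := by
        rw [intervalIntegral.integral_add ((hcs.const_mul _).intervalIntegrable _ _)
          ((hcj.const_mul _).intervalIntegrable _ _), intervalIntegral.integral_const_mul,
          intervalIntegral.integral_const_mul, div_eq_mul_inv]
    _ ≤ M * jb m ^ (-κ) * swtBound k μ + 3 * c ^ 2 * M * K * (L ^ 2 * (jb m ^ 2)⁻¹) *
        ((2 * c)⁻¹ * (8 / (2 - κ) * jb m ^ (2 - κ))) := by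
        gcongr
        exact intervalIntegral.integral_nonneg ht.le fun τ _ => Real.rpow_nonneg (jb_pos _).le _
    _ = M * jb m ^ (-κ) * swtBound k μ + 3 * c ^ 2 * M * K * L ^ 2 *
        ((2 * c)⁻¹ * (8 / (2 - κ))) * ((jb m ^ 2)⁻¹ * jb m ^ (2 - κ)) := by ring
    _ = _ := by
        rw [hXp, rayConst]
        field_simp
        ring

/-- The weighted estimate for the good derivative away from the time axis. -/
theorem sq_jb_mul_abs_Dp_le {n : ℕ} {k : Fin n → ℝ} (hk : ∀ j, 0 < k j) {c κ μ : ℝ} (hc : 0 < c)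
    (hκ1 : 1 < κ) (hκ2 : κ < 2) (hμ : 0 < μ) {u : Fn} (hu : Smooth u) (h0 : ∀ y, u 0 y = 0)
    (h1 : ∀ y, pt u 0 y = 0) {t M L : ℝ} {x : E3} (ht : 0 < t) (hx : x ≠ 0) (hM : 0 ≤ M)
    (hL : jb (‖x‖ + c * t) ≤ L * ‖x‖) (hG : SrcBound c k κ μ M t x (box c u))
    (hΩ : ∀ i j : Fin 3, i < j → SrcBound c k κ μ M t x (box c (rotA i j (rotA i j u)))) :
    jb (‖x‖ + c * t) ^ 2 * jb (c * t - ‖x‖) ^ (κ - 1) * |Dp c u t x| ≤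
      L * (rayConst c k κ μ L + c * decayConst c k κ μ * L) * M := by
  have hr : 0 < ‖x‖ := norm_pos_iff.2 hx
  have hω : ‖‖x‖⁻¹ • x‖ = 1 := norm_smul_inv_norm (𝕜 := ℝ) hx
  have hrω : ‖x‖ • ‖x‖⁻¹ • x = x := smul_inv_smul₀ hr.ne' x
  have hray := abs_rayVal_le hk hc hκ1 hκ2 hμ hu h0 h1 ht hr hM hL hω
    (by rwa [hrω]) (by rwa [hrω])
  have hdec := norm_mul_abs_le hk hc hκ1 hμ hu h0 h1 ht.le hM hG
  have hval : rayVal c u (‖x‖⁻¹ • x) t ‖x‖ = c * u t x + ‖x‖ * Dp c u t x := by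
    rw [rayVal, hrω, Dp, pr]
    simp only [PiLp.smul_apply, smul_eq_mul, div_eq_inv_mul]
  rw [hval] at hray
  have hK := decayConst_nonneg hk hc hκ1 μ
  set K := decayConst c k κ μ
  set X := jb (‖x‖ + c * t) with hXdef
  set J := jb (c * t - ‖x‖) with hJdef
  set K' := rayConst c k κ μ L
  have hX : 0 < X := jb_pos _
  have hJ : 0 < J := jb_pos _
  have hct : 0 < c * t := by positivity
  have hJX : J ≤ X := jb_le_jb (by
    rw [abs_of_pos (by positivity : 0 < ‖x‖ + c * t), abs_le]
    constructor <;> linarith)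
  have hL0 : 0 < L := by
    by_contra hneg
    have : L * ‖x‖ ≤ 0 := mul_nonpos_of_nonpos_of_nonneg (not_lt.1 hneg) hr.le
    linarith
  have hK' : 0 ≤ M * K' := by
    have hXκ := Real.rpow_pos_of_pos hX (-κ)
    exact nonneg_of_mul_nonneg_left ((abs_nonneg _).trans hray) hXκ
  have hJJ : J ^ (κ - 1) * J ^ (1 - κ) = 1 := by
    rw [← Real.rpow_add hJ]
    norm_num
  have hXX : X * X ^ (-κ) * X ^ (κ - 1) = 1 := by
    nth_rewrite 1 [← Real.rpow_one X]
    rw [← Real.rpow_add hX, ← Real.rpow_add hX, show 1 + -κ + (κ - 1) = 0 by ring, Real.rpow_zero]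
  have hJXκ : J ^ (κ - 1) ≤ X ^ (κ - 1) := Real.rpow_le_rpow hJ.le hJX (by linarith)
  have hJκ : 0 < J ^ (κ - 1) := Real.rpow_pos_of_pos hJ _
  have hXκ : 0 < X ^ (-κ) := Real.rpow_pos_of_pos hX _
  have hu' : X * |u t x| ≤ L * (M * (K * J ^ (1 - κ))) := by
    calc X * |u t x| ≤ L * ‖x‖ * |u t x| := by gcongr
      _ = L * (‖x‖ * |u t x|) := by ring
      _ ≤ _ := by gcongr
  have hD : ‖x‖ * |Dp c u t x| ≤ M * K' * X ^ (-κ) + c * |u t x| := by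
    have e1 : ‖x‖ * |Dp c u t x| = |(c * u t x + ‖x‖ * Dp c u t x) - c * u t x| := by
      rw [add_sub_cancel_left, abs_mul, abs_of_pos hr]
    have e2 : |c * u t x| = c * |u t x| := by rw [abs_mul, abs_of_pos hc]
    rw [e1, ← e2]
    exact (abs_sub _ _).trans (add_le_add hray le_rfl)
  calc X ^ 2 * J ^ (κ - 1) * |Dp c u t x| = J ^ (κ - 1) * X * (X * |Dp c u t x|) := by ring
    _ ≤ J ^ (κ - 1) * X * (L * ‖x‖ * |Dp c u t x|) := by gcongr
    _ = J ^ (κ - 1) * X * (L * (‖x‖ * |Dp c u t x|)) := by ring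
    _ ≤ J ^ (κ - 1) * X * (L * (M * K' * X ^ (-κ) + c * |u t x|)) := by gcongr
    _ = L * (M * K' * (X * X ^ (-κ) * J ^ (κ - 1)) + c * (J ^ (κ - 1) * (X * |u t x|))) := by ring
    _ ≤ L * (M * K' * (X * X ^ (-κ) * X ^ (κ - 1)) +
        c * (J ^ (κ - 1) * (L * (M * (K * J ^ (1 - κ)))))) := by gcongr
    _ = L * (M * K' * (X * X ^ (-κ) * X ^ (κ - 1)) +
        c * L * M * K * (J ^ (κ - 1) * J ^ (1 - κ))) := by ring
    _ = _ := by
      rw [hXX, hJJ]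
      ring

theorem mem_multiIdx {s : ℕ} {α : Fin 7 → ℕ} (h : ∑ i, α i ≤ s) : α ∈ multiIdx s := by
  rw [multiIdx, Finset.mem_filter, Fintype.mem_piFinset]
  refine ⟨fun i => Finset.mem_range.2 (Nat.lt_succ_of_le (le_trans ?_ h)), h⟩
  exact Finset.single_le_sum (f := α) (fun _ _ => Nat.zero_le _) (Finset.mem_univ i)

theorem abs_Zpow_le_vnorm {s : ℕ} {α : Fin 7 → ℕ} (h : ∑ i, α i ≤ s) (f : Fn) (t : ℝ) (x : E3) :
    |Zpow α f t x| ≤ vnorm s f t x :=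
  Finset.single_le_sum (f := fun α => |Zpow α f t x|) (fun _ _ => abs_nonneg _) (mem_multiIdx h)

theorem exists_wgt_eq {N : ℕ} (cs : Fin N → ℝ) (t r : ℝ) :
    ∃ j, wgt cs t r = jb (cs0 cs j * t - r) := by
  obtain ⟨j, -, hj⟩ := Finset.exists_mem_eq_inf' (s := Finset.univ) Finset.univ_nonempty
    fun j : Fin (N + 1) => jb (cs0 cs j * t - r)
  exact ⟨j, hj⟩

theorem one_le_wgt {N : ℕ} (cs : Fin N → ℝ) (t r : ℝ) : 1 ≤ wgt cs t r := by
  obtain ⟨j, hj⟩ := exists_wgt_eq cs t r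
  exact hj ▸ one_le_jb _

theorem continuous_wgt {N : ℕ} (cs : Fin N → ℝ) :
    Continuous fun p : ℝ × ℝ => wgt cs p.1 p.2 := by
  refine Continuous.finset_inf'_apply _ fun j _ => ?_
  exact continuous_jb.comp (by fun_prop)

theorem Smooth.continuous_vnorm {f : Fn} (hf : Smooth f) (s : ℕ) :
    Continuous fun p : ℝ × E3 => vnorm s f p.1 p.2 :=
  continuous_finsetSum _ fun α _ => (hf.Zpow α).continuous.abs

/-- The supremum defining `Afun` is attained over a bounded set. -/
theorem le_Afun (ρ μ : ℝ) (s : ℕ) {G : Fn} (hG : Smooth G) (c : ℝ) {N : ℕ} (cs : Fin N → ℝ)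
    (hc : 0 ≤ c) {t : ℝ} {x : E3} {τ : ℝ} {y : E3} (h0 : 0 ≤ τ) (h1 : τ ≤ t)
    (h2 : ‖y - x‖ ≤ c * (t - τ)) :
    ‖y‖ * jb (τ + ‖y‖) ^ ρ * wgt cs τ ‖y‖ ^ (1 + μ) * vnorm s G τ y ≤ Afun ρ μ s G c cs t x := by
  refine le_csSup ?_ ⟨τ, y, h0, h1, h2, rfl⟩
  have hcont : Continuous fun p : ℝ × E3 =>
      ‖p.2‖ * jb (p.1 + ‖p.2‖) ^ ρ * wgt cs p.1 ‖p.2‖ ^ (1 + μ) * vnorm s G p.1 p.2 := by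
    have hw : Continuous fun p : ℝ × E3 => wgt cs p.1 ‖p.2‖ :=
      Continuous.comp (g := fun p : ℝ × ℝ => wgt cs p.1 p.2)
        (f := fun p : ℝ × E3 => (p.1, ‖p.2‖)) (continuous_wgt cs) (by fun_prop)
    exact ((continuous_snd.norm.mul (continuous_jb_rpow (by fun_prop) _)).mul
      (hw.rpow_const fun p => Or.inl (one_pos.trans_le (one_le_wgt _ _ _)).ne')).mul
        (hG.continuous_vnorm s)
  have hK : IsCompact (Set.Icc 0 t ×ˢ Metric.closedBall x (c * t)) :=
    isCompact_Icc.prod (isCompact_closedBall x (c * t))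
  refine (hK.image hcont).bddAbove.mono ?_
  rintro a ⟨τ, y, h0, h1, h2, rfl⟩
  refine ⟨(τ, y), ⟨⟨h0, h1⟩, ?_⟩, rfl⟩
  rw [Metric.mem_closedBall, dist_eq_norm]
  exact h2.trans (mul_le_mul_of_nonneg_left (by linarith) hc)

theorem weight_mul_abs_Zpow_le_Afun {κ μ : ℝ} {s : ℕ} {α : Fin 7 → ℕ} (hα : ∑ i, α i ≤ s) {G : Fn}
    (hG : Smooth G) {c : ℝ} {N : ℕ} (cs : Fin N → ℝ) (hc : 0 ≤ c) {t : ℝ} {x : E3} {τ : ℝ} {y : E3}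
    (h0 : 0 ≤ τ) (h1 : τ ≤ t) (h2 : ‖y - x‖ ≤ c * (t - τ)) :
    jb (τ + ‖y‖) ^ κ * wgt cs τ ‖y‖ ^ (1 + μ) * (‖y‖ * |Zpow α G τ y|) ≤
      Afun κ μ s G c cs t x := by
  have hw := one_pos.trans_le (one_le_wgt cs τ ‖y‖)
  have hj := jb_pos (τ + ‖y‖)
  calc _ = ‖y‖ * jb (τ + ‖y‖) ^ κ * wgt cs τ ‖y‖ ^ (1 + μ) * |Zpow α G τ y| := by ring
    _ ≤ ‖y‖ * jb (τ + ‖y‖) ^ κ * wgt cs τ ‖y‖ ^ (1 + μ) * vnorm s G τ y :=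
        mul_le_mul_of_nonneg_left (abs_Zpow_le_vnorm hα G τ y) (by positivity)
    _ ≤ _ := le_Afun κ μ s hG c cs hc h0 h1 h2

theorem norm_mul_abs_Zpow_le_Afun {κ μ : ℝ} (hκ : 0 ≤ κ) (hμ : 0 ≤ μ) {s : ℕ} {α : Fin 7 → ℕ}
    (hα : ∑ i, α i ≤ s) {G : Fn} (hG : Smooth G) {c : ℝ} {N : ℕ} (cs : Fin N → ℝ) (hc : 0 ≤ c)
    {t : ℝ} {x : E3} {τ : ℝ} {y : E3} (h0 : 0 ≤ τ) (h1 : τ ≤ t) (h2 : ‖y - x‖ ≤ c * (t - τ)) :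
    ‖y‖ * |Zpow α G τ y| ≤ Afun κ μ s G c cs t x := by
  refine le_trans ?_ (weight_mul_abs_Zpow_le_Afun hα hG cs hc h0 h1 h2)
  exact le_mul_of_one_le_left (by positivity) (one_le_mul_of_one_le_of_one_le
    (Real.one_le_rpow (one_le_jb _) hκ) (Real.one_le_rpow (one_le_wgt _ _ _) (by linarith)))

theorem Afun_nonneg (κ μ : ℝ) (s : ℕ) (G : Fn) (c : ℝ) {N : ℕ} (cs : Fin N → ℝ) (t : ℝ) (x : E3) :
    0 ≤ Afun κ μ s G c cs t x := by
  refine Real.sSup_nonneg ?_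
  rintro a ⟨τ, y, -, -, -, rfl⟩
  have hw := one_pos.trans_le (one_le_wgt cs τ ‖y‖)
  have hj := jb_pos (τ + ‖y‖)
  have hv : 0 ≤ vnorm s G τ y := Finset.sum_nonneg fun _ _ => abs_nonneg _
  positivity

/-- Derivatives of the source satisfy `SrcBound` with the weighted supremum as constant. -/
theorem srcBound_Zpow {κ μ : ℝ} (hκ : 0 ≤ κ) {s : ℕ} {α : Fin 7 → ℕ}
    (hα : ∑ i, α i ≤ s) {G : Fn} (hG : Smooth G) {c : ℝ} {N : ℕ} (cs : Fin N → ℝ) (hc : 0 ≤ c)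
    (t : ℝ) (x : E3) :
    SrcBound c (fun j => cs0 cs j + c) κ μ ((1 + c) ^ κ * Afun κ μ s G c cs t x) t x
      (Zpow α G) := by
  intro τ y h0 h1 h2
  have h := weight_mul_abs_Zpow_le_Afun (κ := κ) (μ := μ) hα hG cs hc h0 h1 h2
  set A := Afun κ μ s G c cs t x
  set l := ‖y‖ with hl
  have hl0 : 0 ≤ l := norm_nonneg y
  have hw := one_pos.trans_le (one_le_wgt cs τ l)
  have hj := jb_pos (τ + l)
  have hj' := jb_pos (c * τ + l)
  have hA : 0 ≤ A := Afun_nonneg _ _ _ _ _ _ _ _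
  have hsw : wgt cs τ l ^ (-(1 + μ)) ≤ swt (fun j => cs0 cs j + c) μ τ (c * τ + l) := by
    obtain ⟨j, hj⟩ := exists_wgt_eq cs τ l
    rw [hj, show cs0 cs j * τ - l = (cs0 cs j + c) * τ - (c * τ + l) by ring]
    exact Finset.single_le_sum
      (f := fun j => jb ((cs0 cs j + c) * τ - (c * τ + l)) ^ (-(1 + μ)))
      (fun _ _ => Real.rpow_nonneg (jb_pos _).le _) (Finset.mem_univ j)
  have hjj : jb (τ + l) ^ (-κ) ≤ (1 + c) ^ κ * jb (c * τ + l) ^ (-κ) := by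
    have h3 : jb (c * τ + l) ≤ (1 + c) * jb (τ + l) := by
      refine jb_le_mul (by linarith) ?_
      rw [abs_of_nonneg (by positivity), abs_of_nonneg (by positivity)]
      nlinarith [mul_nonneg hc hl0]
    have h4 : jb (c * τ + l) ^ κ ≤ (1 + c) ^ κ * jb (τ + l) ^ κ := by
      rw [← Real.mul_rpow (by positivity) hj.le]
      exact Real.rpow_le_rpow hj'.le h3 hκ
    rw [Real.rpow_neg hj.le, Real.rpow_neg hj'.le, ← div_eq_mul_inv, inv_eq_one_div,
      div_le_div_iff₀ (by positivity) (by positivity), one_mul]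
    exact h4
  have hone : jb (τ + l) ^ (-κ) * wgt cs τ l ^ (-(1 + μ)) *
      (jb (τ + l) ^ κ * wgt cs τ l ^ (1 + μ)) = 1 := by
    rw [Real.rpow_neg hj.le, Real.rpow_neg hw.le]
    have h5 : jb (τ + l) ^ κ ≠ 0 := by positivity
    have h6 : wgt cs τ l ^ (1 + μ) ≠ 0 := by positivity
    field_simp
  have hsw0 := swt_nonneg (fun j => cs0 cs j + c) μ τ (c * τ + l)
  calc l * |Zpow α G τ y| = jb (τ + l) ^ (-κ) * wgt cs τ l ^ (-(1 + μ)) *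
        (jb (τ + l) ^ κ * wgt cs τ l ^ (1 + μ) * (l * |Zpow α G τ y|)) := by
        rw [← mul_assoc _ _ (l * |Zpow α G τ y|), hone, one_mul]
    _ ≤ (1 + c) ^ κ * jb (c * τ + l) ^ (-κ) * swt (fun j => cs0 cs j + c) μ τ (c * τ + l) * A := by
        gcongr
    _ = _ := by
        rw [srcWt]
        ring

theorem eq_of_eq_Ioi {f g : ℝ → ℝ} (hf : Continuous f) (hg : Continuous g)
    (h : ∀ t, 0 < t → f t = g t) {t : ℝ} (ht : 0 ≤ t) : f t = g t := by
  have hcl : IsClosed {t | f t = g t} := isClosed_eq hf hg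
  have hsub : closure (Set.Ioi (0:ℝ)) ⊆ {t | f t = g t} := closure_minimal h hcl
  rw [closure_Ioi] at hsub
  exact hsub ht

theorem Smooth.continuous_left {f : Fn} (hf : Smooth f) (x : E3) : Continuous fun t => f t x :=
  hf.continuous.comp (Continuous.prodMk_left x)

theorem IsWaveSol.box_eq {c : ℝ} {G u : Fn} (h : IsWaveSol c G u) (hG : Smooth G) {t : ℝ}
    (ht : 0 ≤ t) : box c u t = G t := by
  funext x
  exact eq_of_eq_Ioi ((h.1.box c).continuous_left x) (hG.continuous_left x)
    (fun t ht => h.2.1 t x ht) ht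

theorem pd_congr {f g : Fn} {t : ℝ} (h : f t = g t) (j : Fin 3) : pd j f t = pd j g t := by
  unfold pd
  rw [h]

theorem rotA_congr {f g : Fn} {t : ℝ} (h : f t = g t) (j k : Fin 3) :
    rotA j k f t = rotA j k g t := by
  unfold rotA
  rw [pd_congr h, pd_congr h]

theorem pt_congr {f g : Fn} (hf : Smooth f) (hg : Smooth g) (h : ∀ t, 0 ≤ t → f t = g t)
    {t : ℝ} (ht : 0 ≤ t) : pt f t = pt g t := by
  funext x
  refine eq_of_eq_Ioi (hf.pt.continuous_left x) (hg.pt.continuous_left x) (fun t ht => ?_) ht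
  refine Filter.EventuallyEq.deriv_eq ?_
  filter_upwards [lt_mem_nhds ht] with s hs
  rw [h s hs.le]

theorem pd_eq_zero {f : Fn} {t : ℝ} (h : ∀ x, f t x = 0) (j : Fin 3) (x : E3) :
    pd j f t x = 0 := by
  have : f t = fun _ => 0 := funext h
  simp [pd, this]

theorem IsWaveSol.pt_pt_zero {c : ℝ} {G u : Fn} (h : IsWaveSol c G u) (hG : Smooth G) (x : E3) :
    pt (pt u) 0 x = G 0 x := by
  have hb := congrFun (h.box_eq hG le_rfl) x
  have hl : lap u 0 x = 0 :=
    Finset.sum_eq_zero fun j _ => pd_eq_zero (pd_eq_zero h.2.2.1 j) j x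
  rwa [box, hl, mul_zero, sub_zero] at hb

/-- The estimate in terms of the bound `A` for unweighted first derivatives of the source. -/
theorem IsWaveSol.abs_Dp_le {c : ℝ} (hc : 0 < c) {G u : Fn} (h : IsWaveSol c G u)
    (hG : Smooth G) {t A : ℝ} (ht : 0 < t) {x : E3} (hx : x ≠ 0) (hA : 0 ≤ A)
    (hb : ∀ α : Fin 7 → ℕ, ∑ i, α i ≤ 2 → ∀ τ y, 0 ≤ τ → τ ≤ t → ‖y - x‖ ≤ c * (t - τ) →
      ‖y‖ * |Zpow α G τ y| ≤ A) :
    |Dp c u t x| ≤ ((1 + t) / c + 3 * t) * A := by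
  obtain ⟨hu, -, h0, h1⟩ := id h
  have hx0 : 0 < ‖x‖ := norm_pos_iff.2 hx
  have hpt : c * |pt u t x| ≤ A + A * t := by
    refine abs_le_of_bounded hu.pt hc ht hA hA hx h1 (fun y hy => ?_) fun τ y e0 e1 e2 => ?_
    · rw [h.pt_pt_zero hG]
      exact hb 0 (by simp) 0 y le_rfl ht.le (by simpa using hy)
    · rw [box_pt hu, pt_congr (hu.box c) hG (fun t ht => h.box_eq hG ht) e0]
      exact hb ![1, 0, 0, 0, 0, 0, 0] (by decide) τ y e0 e1 e2
  have hpd : ∀ j, c * |pd j u t x| ≤ A * t := by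
    intro j
    have := abs_le_of_bounded (hu.pd j) hc ht le_rfl hA hx (pd_eq_zero h0 j)
      (fun y _ => by rw [hu.pt_pd_comm, pd_eq_zero h1 j]; simp) fun τ y e0 e1 e2 => by
        rw [box_pd hu, pd_congr (h.box_eq hG e0)]
        fin_cases j
        · exact hb ![0, 1, 0, 0, 0, 0, 0] (by decide) τ y e0 e1 e2
        · exact hb ![0, 0, 1, 0, 0, 0, 0] (by decide) τ y e0 e1 e2
        · exact hb ![0, 0, 0, 1, 0, 0, 0] (by decide) τ y e0 e1 e2
    simpa using this
  have hpr : c * |pr u t x| ≤ 3 * (A * t) := by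
    calc c * |pr u t x| ≤ c * ∑ j, |x j / ‖x‖ * pd j u t x| := by
          gcongr
          exact Finset.abs_sum_le_sum_abs _ _
      _ ≤ c * ∑ j, |pd j u t x| := by
          refine mul_le_mul_of_nonneg_left (Finset.sum_le_sum fun j _ => ?_) hc.le
          rw [abs_mul]
          refine mul_le_of_le_one_left (abs_nonneg _) ?_
          rw [abs_div, abs_of_pos hx0, div_le_one hx0]
          exact PiLp.norm_apply_le x j
      _ = ∑ j, c * |pd j u t x| := Finset.mul_sum _ _ _
      _ ≤ ∑ _j : Fin 3, A * t := Finset.sum_le_sum fun j _ => hpd j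
      _ = _ := by simp
  have hpt' : |pt u t x| ≤ (A + A * t) / c := by
    rw [le_div_iff₀ hc, mul_comm]
    exact hpt
  calc |Dp c u t x| ≤ |pt u t x| + |c * pr u t x| := abs_add_le _ _
    _ = |pt u t x| + c * |pr u t x| := by rw [abs_mul, abs_of_pos hc]
    _ ≤ (A + A * t) / c + 3 * (A * t) := add_le_add hpt' hpr
    _ = _ := by ring

theorem cs0_nonneg {N : ℕ} {cs : Fin N → ℝ} (hcs : ∀ j, 0 < cs j) (j : Fin (N + 1)) :
    0 ≤ cs0 cs j := by
  exact Fin.cases le_rfl (fun i => (hcs i).le) j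

theorem IsWaveSol.sq_jb_mul_abs_Dp_le {c : ℝ} (hc : 0 < c) {N : ℕ} {cs : Fin N → ℝ}
    (hcs : ∀ j, 0 < cs j) {κ μ : ℝ} (hκ1 : 1 < κ) (hκ2 : κ < 2) (hμ : 0 < μ) {G u : Fn}
    (hG : Smooth G) (h : IsWaveSol c G u) {t L : ℝ} {x : E3} (ht : 0 < t) (hx : x ≠ 0)
    (hL : jb (‖x‖ + c * t) ≤ L * ‖x‖) :
    jb (‖x‖ + c * t) ^ 2 * jb (c * t - ‖x‖) ^ (κ - 1) * |Dp c u t x| ≤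
      L * (rayConst c (fun j => cs0 cs j + c) κ μ L +
        c * decayConst c (fun j => cs0 cs j + c) κ μ * L) *
        ((1 + c) ^ κ * Afun κ μ 2 G c cs t x) := by
  obtain ⟨hu, -, h0, h1⟩ := id h
  have hA := Afun_nonneg κ μ 2 G c cs t x
  have hsrc := fun (α : Fin 7 → ℕ) (hα : ∑ i, α i ≤ 2) =>
    srcBound_Zpow (κ := κ) (μ := μ) (by linarith) hα hG cs hc.le t x
  refine PaperKatayama.sq_jb_mul_abs_Dp_le (fun j => add_pos_of_nonneg_of_pos (cs0_nonneg hcs j) hc)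
    hc hκ1 hκ2 hμ hu h0 h1 ht hx (by positivity) hL ?_ ?_
  · intro τ y e0 e1 e2
    rw [h.box_eq hG e0]
    exact hsrc 0 (by simp) τ y e0 e1 e2
  · intro i j hij τ y e0 e1 e2
    rw [box_rotA (hu.rotA i j) c i j hij.ne, box_rotA hu c i j hij.ne,
      rotA_congr (rotA_congr (h.box_eq hG e0) i j) i j]
    have hcases : (i = 0 ∧ j = 1) ∨ (i = 0 ∧ j = 2) ∨ (i = 1 ∧ j = 2) := by omega
    rcases hcases with ⟨rfl, rfl⟩ | ⟨rfl, rfl⟩ | ⟨rfl, rfl⟩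
    · exact hsrc ![0, 0, 0, 0, 2, 0, 0] (by decide) τ y e0 e1 e2
    · exact hsrc ![0, 0, 0, 0, 0, 2, 0] (by decide) τ y e0 e1 e2
    · exact hsrc ![0, 0, 0, 0, 0, 0, 2] (by decide) τ y e0 e1 e2

theorem stmt1 (c : ℝ) (hc : 0 < c) {N : ℕ} (cs : Fin N → ℝ) (hcs : ∀ j, 0 < cs j)
    (κ μ δ : ℝ) (hκ1 : 1 < κ) (hκ2 : κ < 2) (hμ : 0 < μ) (hδ : 0 < δ) :
    ∃ C > (0 : ℝ), ∀ G u : Fn, Smooth G → IsWaveSol c G u →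
      ∀ (t : ℝ) (x : E3), 0 < t → δ * t < ‖x‖ →
        jb (t + ‖x‖) ^ 2 * jb (c * t - ‖x‖) ^ (κ - 1) * |Dp c u t x| ≤
          C * Afun κ μ 2 G c cs t x := by
  set L : ℝ := 2 + c / δ with hLdef
  set C₁ : ℝ := (2 + 1 / δ) ^ 2 * L * ((1 + 1 / δ) / c + 3 * (1 / δ)) with hC₁
  set C₂ : ℝ := (1 + 1 / c) ^ 2 * (L * (rayConst c (fun j => cs0 cs j + c) κ μ L +
    c * decayConst c (fun j => cs0 cs j + c) κ μ * L) * (1 + c) ^ κ) with hC₂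
  have hC₁pos : 0 < C₁ := by positivity
  refine ⟨C₁ + |C₂|, by positivity, fun G u hG hu t x ht hx => ?_⟩
  have hA := Afun_nonneg κ μ 2 G c cs t x
  set A := Afun κ μ 2 G c cs t x with hAdef
  have hr : 0 < ‖x‖ := (mul_pos hδ ht).trans hx
  have hx0 : x ≠ 0 := norm_pos_iff.1 hr
  have htr : t ≤ ‖x‖ / δ := by
    rw [le_div_iff₀ hδ, mul_comm]
    exact hx.le
  have hct : 0 < c * t := by positivity
  have hctr : c * t ≤ c / δ * ‖x‖ := by
    calc c * t ≤ c * (‖x‖ / δ) := by gcongr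
      _ = _ := by ring
  have hJ := jb_pos (c * t - ‖x‖)
  rcases lt_or_ge ‖x‖ 1 with h1 | h1
  · have ht1 : t ≤ 1 / δ := htr.trans (by gcongr)
    have hctδ : c * t ≤ c / δ := hctr.trans (mul_le_of_le_one_right (by positivity) h1.le)
    have hD := hu.abs_Dp_le hc hG ht hx0 hA fun α hα τ y e0 e1 e2 =>
      norm_mul_abs_Zpow_le_Afun (by linarith) hμ.le hα hG cs hc.le e0 e1 e2
    have hT : jb (t + ‖x‖) ≤ 2 + 1 / δ :=
      (jb_le_one_add (by positivity)).trans (by linarith)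
    have hJ1 : jb (c * t - ‖x‖) ^ (κ - 1) ≤ L := by
      calc _ ≤ jb (c * t - ‖x‖) ^ (1 : ℝ) :=
            Real.rpow_le_rpow_of_exponent_le (one_le_jb _) (by linarith)
        _ ≤ jb (c * t + ‖x‖) := by
            rw [Real.rpow_one]
            refine jb_le_jb ?_
            rw [abs_of_pos (by positivity : 0 < c * t + ‖x‖), abs_le]
            constructor <;> linarith
        _ ≤ L := (jb_le_one_add (by positivity)).trans (by linarith)
    have hT0 := jb_pos (t + ‖x‖)
    calc _ ≤ (2 + 1 / δ) ^ 2 * L * (((1 + t) / c + 3 * t) * A) := by gcongr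
      _ ≤ (2 + 1 / δ) ^ 2 * L * (((1 + 1 / δ) / c + 3 * (1 / δ)) * A) := by gcongr
      _ = C₁ * A := by rw [hC₁]; ring
      _ ≤ _ := by
        gcongr
        exact le_add_of_nonneg_right (abs_nonneg _)
  · have hL : jb (‖x‖ + c * t) ≤ L * ‖x‖ :=
      (jb_le_one_add (by positivity)).trans (by rw [hLdef]; linarith)
    have hmain := hu.sq_jb_mul_abs_Dp_le hc hcs hκ1 hκ2 hμ hG ht hx0 hL
    have hT : jb (t + ‖x‖) ≤ (1 + 1 / c) * jb (‖x‖ + c * t) := by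
      refine jb_le_mul (by linarith [one_div_pos.2 hc]) ?_
      rw [abs_of_pos (by positivity), abs_of_pos (by positivity)]
      have e1 : (1 + 1 / c) * (‖x‖ + c * t) = ‖x‖ + c * t + ‖x‖ / c + t := by
        field_simp
        ring
      have e2 : 0 < ‖x‖ / c := by positivity
      linarith
    have hT0 := jb_pos (t + ‖x‖)
    calc _ ≤ ((1 + 1 / c) * jb (‖x‖ + c * t)) ^ 2 * jb (c * t - ‖x‖) ^ (κ - 1) *
          |Dp c u t x| := by gcongr
      _ = (1 + 1 / c) ^ 2 *
          (jb (‖x‖ + c * t) ^ 2 * jb (c * t - ‖x‖) ^ (κ - 1) * |Dp c u t x|) := by ring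
      _ ≤ (1 + 1 / c) ^ 2 * _ := mul_le_mul_of_nonneg_left hmain (by positivity)
      _ = C₂ * A := by rw [hC₂]; ring
      _ ≤ _ := by
        gcongr
        linarith [le_abs_self C₂]

end PaperKatayama
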